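/- arXiv:1205.3460 — 2 statements merged into one kernel-verified Lean document; each statement's English description precedes it below -/
import Mathlib

section
/- Let (M³, g) be a three-dimensional gradient Ricci soliton, i.e. Ric + ∇²f = λ g for a smooth function f: M → ℝ and a constant λ ∈ ℝ. Then the tensor T = (Ric − (R/2) g) e^{−f}, where R denotes the scalar curvature of g, is a Codazzi tensor on (M³, g). -/
noncomputable section

open scoped RealInnerProductSpace

/-- Euclidean model space `ℝⁿ`. -/
abbrev E (n : ℕ) : Type := EuclideanSpace ℝ (Fin n)

/-- The `i`-th standard coordinate vector of `ℝⁿ`. -/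
noncomputable def e (n : ℕ) (i : Fin n) : E n := EuclideanSpace.single i 1

/-- A smooth Riemannian metric, written in a single coordinate chart `U ⊆ ℝⁿ`, together
with its inverse metric and its Levi-Civita connection (encoded via the Christoffel
symbols `Γ`).  The fields `Γ_symm` (torsion-freeness) and `compat` (metric compatibility)
characterise the Levi-Civita connection uniquely. -/
structure RiemannChart (n : ℕ) where
  U : Set (E n)
  hU : IsOpen U
  g : E n → E n → E n → ℝ
  g_lin : ∀ p (a : ℝ) u v w, g p (a • u + v) w = a * g p u w + g p v w
  g_symm : ∀ p v w, g p v w = g p w v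
  g_posdef : ∀ p ∈ U, ∀ v, v ≠ 0 → 0 < g p v v
  g_smooth : ∀ v w, ContDiffOn ℝ (⊤ : ℕ∞) (fun q => g q v w) U
  ginv : E n → E n → E n → ℝ
  ginv_symm : ∀ p v w, ginv p v w = ginv p w v
  ginv_g : ∀ p ∈ U, ∀ i j : Fin n,
    (∑ k : Fin n, ginv p (e n i) (e n k) * g p (e n k) (e n j)) = if i = j then 1 else 0
  Γ : E n → E n → E n → E n
  Γ_lin : ∀ p (a : ℝ) u v w, Γ p (a • u + v) w = a • Γ p u w + Γ p v w
  Γ_symm : ∀ p v w, Γ p v w = Γ p w v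
  Γ_smooth : ∀ v w, ContDiffOn ℝ (⊤ : ℕ∞) (fun q => Γ q v w) U
  compat : ∀ p ∈ U, ∀ v w u,
    fderiv ℝ (fun q => g q w u) p v = g p (Γ p v w) u + g p w (Γ p v u)

namespace RiemannChart

variable {n : ℕ} (D : RiemannChart n)

/-- Covariant derivative `∇_v Y` of a vector field `Y` at `p`. -/
def covDeriv (Y : E n → E n) (p v : E n) : E n :=
  fderiv ℝ Y p v + D.Γ p v (Y p)

/-- Covariant derivative `(∇_v T)(w,u)` of a `(0,2)`-tensor field `T` at `p`. -/
def covDeriv2 (T : E n → E n → E n → ℝ) (p v w u : E n) : ℝ :=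
  fderiv ℝ (fun q => T q w u) p v - T p (D.Γ p v w) u - T p w (D.Γ p v u)

/-- `T` is a Codazzi tensor on `U`: a smooth symmetric bilinear form whose covariant
derivative is totally symmetric. -/
def IsCodazzi (T : E n → E n → E n → ℝ) : Prop :=
  (∀ p ∈ D.U, ∀ v w, T p v w = T p w v) ∧
  (∀ p ∈ D.U, ∀ (a : ℝ) u v w, T p (a • u + v) w = a * T p u w + T p v w) ∧
  (∀ v w, ContDiffOn ℝ (⊤ : ℕ∞) (fun q => T q v w) D.U) ∧
  (∀ p ∈ D.U, ∀ v w u, D.covDeriv2 T p v w u = D.covDeriv2 T p w v u)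

/-- The eigenspace (as a set) of the symmetric bilinear form `T` with respect to `g`,
at the point `p`, for the eigenvalue `lam`. -/
def eigenSet (T : E n → E n → E n → ℝ) (p : E n) (lam : ℝ) : Set (E n) :=
  {v | ∀ w, T p v w = lam * D.g p v w}

/-- The multiplicity of `lam` as an eigenvalue of `T` with respect to `g` at `p`. -/
def eigenMult (T : E n → E n → E n → ℝ) (p : E n) (lam : ℝ) : ℕ :=
  Module.finrank ℝ (Submodule.span ℝ (D.eigenSet T p lam))

/-- `T` has, at every point of `U`, exactly the two distinct eigenvalues `ρ p` (of
multiplicity `1`) and `σ p` (of multiplicity `n - 1`). -/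
def HasTwoEigenvalues (T : E n → E n → E n → ℝ) (ρ σ : E n → ℝ) : Prop :=
  (∀ p ∈ D.U, ρ p ≠ σ p) ∧
  (∀ p ∈ D.U, D.eigenMult T p (ρ p) = 1) ∧
  (∀ p ∈ D.U, D.eigenMult T p (σ p) = n - 1)

/-- The Riemann curvature tensor `R(v,w)z` at `p`, computed from the Christoffel
symbols by the usual coordinate formula. -/
def Riem (p v w z : E n) : E n :=
  fderiv ℝ (fun q => D.Γ q w z) p v - fderiv ℝ (fun q => D.Γ q v z) p w
    + D.Γ p v (D.Γ p w z) - D.Γ p w (D.Γ p v z)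

/-- The Ricci tensor `Ric(v,w) = tr (z ↦ R(z,v)w)` at `p`. -/
def Ric (p v w : E n) : ℝ := ∑ i : Fin n, D.Riem p (e n i) v w i

/-- The scalar curvature at `p`. -/
def scalar (p : E n) : ℝ :=
  ∑ i : Fin n, ∑ j : Fin n, D.ginv p (e n i) (e n j) * D.Ric p (e n i) (e n j)

/-- The Hessian `∇²f(v,w)` of a function `f` at `p`. -/
def Hess (f : E n → ℝ) (p v w : E n) : ℝ :=
  fderiv ℝ (fun q => fderiv ℝ f q w) p v - fderiv ℝ f p (D.Γ p v w)

/-- The gradient Ricci soliton equation `Ric + ∇²f = λ g` on `U`. -/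
def IsGradientSoliton (f : E n → ℝ) (lam : ℝ) : Prop :=
  ContDiffOn ℝ (⊤ : ℕ∞) f D.U ∧
  ∀ p ∈ D.U, ∀ v w, D.Ric p v w + D.Hess f p v w = lam * D.g p v w

/-- Strictly positive sectional curvature on `U`. -/
def PosSec : Prop :=
  ∀ p ∈ D.U, ∀ v w,
    0 < D.g p v v * D.g p w w - (D.g p v w) ^ 2 → 0 < D.g p (D.Riem p v w w) v

/-- Nonnegative sectional curvature on `U`. -/
def NonnegSec : Prop :=
  ∀ p ∈ D.U, ∀ v w,
    0 < D.g p v v * D.g p w w - (D.g p v w) ^ 2 → 0 ≤ D.g p (D.Riem p v w w) v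

/-- The distribution `Vd` is totally geodesic (autoparallel) at `p`: the covariant
derivative of any vector field tangent to `Vd`, in a direction tangent to `Vd`,
stays tangent to `Vd`. -/
def TotallyGeodesicAt (Vd : E n → Set (E n)) (p : E n) : Prop :=
  ∀ Y : E n → E n, DifferentiableAt ℝ Y p → (∀ q ∈ D.U, Y q ∈ Vd q) →
    ∀ v ∈ Vd p, D.covDeriv Y p v ∈ Vd p

/-- `S` is an integral hypersurface of the `(n-1)`-dimensional distribution `Vd`:
near each of its points it is a smoothly parametrised hypersurface whose tangent
spaces are given by `Vd`. -/
def IsIntegralHypersurface (Vd : E n → Set (E n)) (S : Set (E n)) : Prop :=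
  S ⊆ D.U ∧
  ∀ q ∈ S, ∃ (φ : E (n - 1) → E n) (V : Set (E n)),
    IsOpen V ∧ q ∈ V ∧ V ⊆ D.U ∧ ContDiff ℝ (⊤ : ℕ∞) φ ∧
    (∀ x, φ x ∈ D.U → Set.range (fun u => fderiv ℝ φ x u) = Vd (φ x)) ∧
    S ∩ V = Set.range φ ∩ V

/-- On the subset `A ⊆ U`, around each of its points the metric is isometric to a
warped product `dt² + w(t)² h` of an `(n-1)`-dimensional Riemannian manifold `(N,h)`
over an interval `I ⊆ ℝ`; moreover `σ` only depends on the interval variable and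
the tangent spaces of the warping hypersurfaces (the `t = const` leaves) are
prescribed by the distribution `Vd`. -/
def LocallyWarpedProductOn (A : Set (E n)) (σ : E n → ℝ) (Vd : E n → Set (E n)) : Prop :=
  ∀ p ∈ A, ∃ (V : Set (E n)) (φ : E n → ℝ × E (n - 1)) (I : Set ℝ) (N : Set (E (n - 1)))
      (w : ℝ → ℝ) (h : E (n - 1) → E (n - 1) → E (n - 1) → ℝ) (s : ℝ → ℝ),
    IsOpen V ∧ p ∈ V ∧ V ⊆ D.U ∧
    IsOpen I ∧ I.OrdConnected ∧ I.Nonempty ∧ IsOpen N ∧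
    ContDiffOn ℝ (⊤ : ℕ∞) φ V ∧ Set.InjOn φ V ∧ φ '' V ⊆ I ×ˢ N ∧
    ContDiff ℝ (⊤ : ℕ∞) w ∧ (∀ t, 0 < w t) ∧
    (∀ x ∈ N, ∀ a b, h x a b = h x b a) ∧
    (∀ x ∈ N, ∀ (c : ℝ) (a a' b : E (n - 1)), h x (c • a + a') b = c * h x a b + h x a' b) ∧
    (∀ x ∈ N, ∀ a, a ≠ 0 → 0 < h x a a) ∧
    (∀ q ∈ V ∩ A, ∀ v u : E n,
      D.g q v u = (fderiv ℝ φ q v).1 * (fderiv ℝ φ q u).1 +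
        (w (φ q).1) ^ 2 * h (φ q).2 (fderiv ℝ φ q v).2 (fderiv ℝ φ q u).2) ∧
    (∀ q ∈ V ∩ A, σ q = s (φ q).1) ∧
    (∀ q ∈ V ∩ A, ∀ v : E n, ((fderiv ℝ φ q v).1 = 0 ↔ v ∈ Vd q))

end RiemannChart

namespace RiemannChart

section LinearAlgebra

variable {n : ℕ} {F : Type*} [AddCommGroup F] [Module ℝ F]

lemma isLinearMap_of_smul_add {L : E n → F} (h : ∀ (a : ℝ) u v, L (a • u + v) = a • L u + L v) :
    IsLinearMap ℝ L := by
  have hadd : ∀ u v, L (u + v) = L u + L v := fun u v => by simpa using h 1 u v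
  have h0 : L 0 = 0 := by simpa using hadd 0 0
  exact ⟨hadd, fun a u => by simpa [h0] using h a u 0⟩

lemma _root_.IsLinearMap.map_smul_add {L : E n → F} (hL : IsLinearMap ℝ L) (a : ℝ) (u v : E n) :
    L (a • u + v) = a • L u + L v := by
  rw [hL.map_add, hL.map_smul]

lemma sum_smul_e (v : E n) : v = ∑ i, v i • e n i := by
  ext j
  simp [e, Finset.sum_apply, Pi.single_apply]

lemma _root_.IsLinearMap.eq_sum_e {L : E n → F} (hL : IsLinearMap ℝ L) (v : E n) :
    L v = ∑ i, v i • L (e n i) := by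
  conv_lhs => rw [sum_smul_e v]
  exact (map_sum (hL.mk' L) (fun i => v i • e n i) Finset.univ).trans
    (Finset.sum_congr rfl fun i _ => hL.map_smul _ _)

lemma _root_.IsLinearMap.map_sum_smul {L : E n → F} (hL : IsLinearMap ℝ L) {ι : Type*}
    (s : Finset ι) (c : ι → ℝ) (b : ι → E n) :
    L (∑ i ∈ s, c i • b i) = ∑ i ∈ s, c i • L (b i) := by
  exact (map_sum (hL.mk' L) (fun i => c i • b i) s).trans
    (Finset.sum_congr rfl fun i _ => hL.map_smul _ _)

lemma sum_comp_apply_comm {L M : E n → E n} (hL : IsLinearMap ℝ L) (hM : IsLinearMap ℝ M) :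
    ∑ i, L (M (e n i)) i = ∑ i, M (L (e n i)) i := by
  have key : ∀ {L M : E n → E n}, IsLinearMap ℝ L →
      ∑ i, L (M (e n i)) i = ∑ i, ∑ k, M (e n i) k * L (e n k) i := by
    intro L M hL
    refine Finset.sum_congr rfl fun i _ => ?_
    rw [hL.eq_sum_e (M (e n i))]
    simp [Finset.sum_apply]
  rw [key hL, key hM, Finset.sum_comm]
  simp_rw [mul_comm]

/-- A trilinear form vanishing on a spanning family vanishes. -/
lemma trilinear_eq_zero {ι : Type*} [Fintype ι] {b : ι → E n} {c : E n → ι → ℝ}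
    (hb : ∀ v, v = ∑ i, c v i • b i) {C : E n → E n → E n → ℝ}
    (h₁ : ∀ w u, IsLinearMap ℝ fun v => C v w u) (h₂ : ∀ v u, IsLinearMap ℝ fun w => C v w u)
    (h₃ : ∀ v w, IsLinearMap ℝ fun u => C v w u) (h : ∀ i j k, C (b i) (b j) (b k) = 0)
    (v w u : E n) : C v w u = 0 := by
  have e₃ : ∀ i j u, C (b i) (b j) u = 0 := fun i j u => by
    rw [hb u, (h₃ _ _).map_sum_smul]; simp [h]
  have e₂ : ∀ i w u, C (b i) w u = 0 := fun i w u => by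
    rw [hb w, (h₂ _ _).map_sum_smul (L := fun w => C (b i) w u)]; simp [e₃]
  rw [hb v, (h₁ _ _).map_sum_smul (L := fun v => C v w u)]; simp [e₂]

end LinearAlgebra

section Calculus

variable {n : ℕ} {F : Type*} [NormedAddCommGroup F] [NormedSpace ℝ F]

lemma hasFDerivAt_coord {Y : E n → E n} {p : E n} (hY : DifferentiableAt ℝ Y p) (i : Fin n) :
    HasFDerivAt (fun q => Y q i) ((EuclideanSpace.proj i).comp (fderiv ℝ Y p)) p :=
  (EuclideanSpace.proj i : E n →L[ℝ] ℝ).hasFDerivAt.comp p hY.hasFDerivAt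

lemma fderiv_coord {Y : E n → E n} {p : E n} (hY : DifferentiableAt ℝ Y p) (i : Fin n) (u : E n) :
    fderiv ℝ (fun q => Y q i) p u = fderiv ℝ Y p u i := by
  rw [(hasFDerivAt_coord hY i).fderiv]; rfl

lemma differentiableAt_linear_apply {S : E n → E n → F} (hS : ∀ q, IsLinearMap ℝ (S q))
    {p : E n} (hd : ∀ v, DifferentiableAt ℝ (fun q => S q v) p) {Y : E n → E n}
    (hY : DifferentiableAt ℝ Y p) : DifferentiableAt ℝ (fun q => S q (Y q)) p := by
  simp_rw [fun q => (hS q).eq_sum_e (Y q)]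
  exact DifferentiableAt.fun_sum fun i _ => (hasFDerivAt_coord hY i).differentiableAt.smul (hd _)

/-- The product rule for a family of linear maps applied to a vector field. -/
lemma fderiv_linear_apply {S : E n → E n → F} (hS : ∀ q, IsLinearMap ℝ (S q))
    {p : E n} (hd : ∀ v, DifferentiableAt ℝ (fun q => S q v) p) {Y : E n → E n}
    (hY : DifferentiableAt ℝ Y p) (u : E n) :
    fderiv ℝ (fun q => S q (Y q)) p u
      = fderiv ℝ (fun q => S q (Y p)) p u + S p (fderiv ℝ Y p u) := by
  rw [(hS p).eq_sum_e (fderiv ℝ Y p u)]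
  simp_rw [fun q => (hS q).eq_sum_e (Y q), fun q => (hS q).eq_sum_e (Y p)]
  have hc : ∀ i, DifferentiableAt ℝ (fun q => Y q i) p :=
    fun i => (hasFDerivAt_coord hY i).differentiableAt
  rw [fderiv_fun_sum fun i _ => (hc i).fun_smul (hd _),
    fderiv_fun_sum fun i _ => (hd _).fun_const_smul (Y p i)]
  simp only [sum_apply, ← Finset.sum_add_distrib]
  refine Finset.sum_congr rfl fun i _ => ?_
  rw [fderiv_fun_smul (hc i) (hd _), fderiv_fun_const_smul (hd _)]
  simp [fderiv_coord hY]

lemma contDiffOn_linear_apply {S : E n → E n → F} (hS : ∀ q, IsLinearMap ℝ (S q)) {U : Set (E n)}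
    (hd : ∀ v, ContDiffOn ℝ (⊤ : ℕ∞) (fun q => S q v) U) {Y : E n → E n}
    (hY : ContDiffOn ℝ (⊤ : ℕ∞) Y U) : ContDiffOn ℝ (⊤ : ℕ∞) (fun q => S q (Y q)) U := by
  simp_rw [fun q => (hS q).eq_sum_e (Y q)]
  exact ContDiffOn.sum fun i _ =>
    ((EuclideanSpace.proj i : E n →L[ℝ] ℝ).contDiff.comp_contDiffOn hY).smul (hd _)

lemma contDiffOn_fderiv_apply {h : E n → F} {U : Set (E n)} (hU : IsOpen U)
    (hh : ContDiffOn ℝ (⊤ : ℕ∞) h U) (v : E n) :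
    ContDiffOn ℝ (⊤ : ℕ∞) (fun q => fderiv ℝ h q v) U :=
  (hh.fderiv_of_isOpen hU (m := (⊤ : ℕ∞)) (by simp)).clm_apply contDiffOn_const

lemma differentiableAt_of_contDiffOn {h : E n → F} {U : Set (E n)} (hU : IsOpen U)
    (hh : ContDiffOn ℝ (⊤ : ℕ∞) h U) {p : E n} (hp : p ∈ U) : DifferentiableAt ℝ h p :=
  (hh.contDiffAt (hU.mem_nhds hp)).differentiableAt (by simp)

lemma fderiv_fderiv_comm {h : E n → F} {U : Set (E n)} (hU : IsOpen U)
    (hh : ContDiffOn ℝ (⊤ : ℕ∞) h U) {p : E n} (hp : p ∈ U) (v w : E n) :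
    fderiv ℝ (fun q => fderiv ℝ h q w) p v = fderiv ℝ (fun q => fderiv ℝ h q v) p w := by
  have hd : DifferentiableAt ℝ (fderiv ℝ h) p :=
    differentiableAt_of_contDiffOn hU
      (hh.fderiv_of_isOpen hU (m := (⊤ : ℕ∞)) (by simp)) hp
  have hs : IsSymmSndFDerivAt ℝ h p :=
    (hh.contDiffAt (hU.mem_nhds hp)).isSymmSndFDerivAt
      (by simpa using WithTop.coe_le_coe.2 (le_top : (2 : ℕ∞) ≤ ⊤))
  have key : ∀ a b : E n, fderiv ℝ (fun q => fderiv ℝ h q b) p a = fderiv ℝ (fderiv ℝ h) p a b := by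
    intro a b
    rw [fderiv_clm_apply hd (differentiableAt_const b)]
    simp
  rw [key, key]
  exact hs.eq v w

end Calculus

section Basic

variable {n : ℕ} (D : RiemannChart n)

lemma g_linear_left (p w : E n) : IsLinearMap ℝ fun v => D.g p v w :=
  isLinearMap_of_smul_add fun a u v => D.g_lin p a u v w

lemma g_linear_right (p v : E n) : IsLinearMap ℝ fun w => D.g p v w := by
  simp_rw [D.g_symm p v]; exact D.g_linear_left p v

lemma Γ_linear_left (p w : E n) : IsLinearMap ℝ fun v => D.Γ p v w :=
  isLinearMap_of_smul_add fun a u v => D.Γ_lin p a u v w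

lemma Γ_linear_right (p v : E n) : IsLinearMap ℝ fun w => D.Γ p v w := by
  simp_rw [D.Γ_symm p v]; exact D.Γ_linear_left p v

lemma g_add_left (p u v w : E n) : D.g p (u + v) w = D.g p u w + D.g p v w :=
  (D.g_linear_left p w).map_add u v

lemma g_sub_left (p u v w : E n) : D.g p (u - v) w = D.g p u w - D.g p v w :=
  (D.g_linear_left p w).map_sub u v

lemma g_neg_left (p u w : E n) : D.g p (-u) w = -D.g p u w :=
  (D.g_linear_left p w).map_neg u

lemma Γ_add_right (p u v w : E n) : D.Γ p w (u + v) = D.Γ p w u + D.Γ p w v :=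
  (D.Γ_linear_right p w).map_add u v

lemma Γ_sub_right (p u v w : E n) : D.Γ p w (u - v) = D.Γ p w u - D.Γ p w v :=
  (D.Γ_linear_right p w).map_sub u v

variable {p : E n}

lemma g_differentiableAt (hp : p ∈ D.U) (v w : E n) :
    DifferentiableAt ℝ (fun q => D.g q v w) p :=
  differentiableAt_of_contDiffOn D.hU (D.g_smooth v w) hp

lemma Γ_differentiableAt (hp : p ∈ D.U) (v w : E n) :
    DifferentiableAt ℝ (fun q => D.Γ q v w) p :=
  differentiableAt_of_contDiffOn D.hU (D.Γ_smooth v w) hp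

lemma dΓ_linear_left (hp : p ∈ D.U) (u z : E n) :
    IsLinearMap ℝ fun w => fderiv ℝ (fun q => D.Γ q w z) p u := by
  refine isLinearMap_of_smul_add fun a w w' => ?_
  simp_rw [D.Γ_lin]
  rw [fderiv_fun_add ((D.Γ_differentiableAt hp _ _).fun_const_smul a) (D.Γ_differentiableAt hp _ _),
    fderiv_fun_const_smul (D.Γ_differentiableAt hp _ _)]
  simp

lemma dΓ_linear_right (hp : p ∈ D.U) (u w : E n) :
    IsLinearMap ℝ fun z => fderiv ℝ (fun q => D.Γ q w z) p u := by
  simp_rw [D.Γ_symm _ w]; exact D.dΓ_linear_left hp u w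

lemma contDiffOn_Γ_apply (v : E n) {Y : E n → E n} (hY : ContDiffOn ℝ (⊤ : ℕ∞) Y D.U) :
    ContDiffOn ℝ (⊤ : ℕ∞) (fun q => D.Γ q v (Y q)) D.U :=
  contDiffOn_linear_apply (S := fun q => D.Γ q v) (fun q => D.Γ_linear_right q v)
    (D.Γ_smooth v) hY

lemma fderiv_Γ_apply (hp : p ∈ D.U) (v : E n) {Y : E n → E n} (hY : DifferentiableAt ℝ Y p)
    (u : E n) :
    fderiv ℝ (fun q => D.Γ q v (Y q)) p u
      = fderiv ℝ (fun q => D.Γ q v (Y p)) p u + D.Γ p v (fderiv ℝ Y p u) :=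
  fderiv_linear_apply (S := fun q => D.Γ q v) (fun q => D.Γ_linear_right q v)
    (D.Γ_differentiableAt hp v) hY u

lemma differentiableAt_g_apply (hp : p ∈ D.U) (y : E n) {Y : E n → E n}
    (hY : DifferentiableAt ℝ Y p) : DifferentiableAt ℝ (fun q => D.g q (Y q) y) p :=
  differentiableAt_linear_apply (S := fun q v => D.g q v y) (fun q => D.g_linear_left q y)
    (fun v => D.g_differentiableAt hp v y) hY

/-- Metric compatibility for a vector field `Y` and a constant vector field `y`. -/
lemma fderiv_g_apply (hp : p ∈ D.U) (y : E n) {Y : E n → E n} (hY : DifferentiableAt ℝ Y p)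
    (u : E n) :
    fderiv ℝ (fun q => D.g q (Y q) y) p u
      = D.g p (D.Γ p u (Y p)) y + D.g p (Y p) (D.Γ p u y) + D.g p (fderiv ℝ Y p u) y := by
  rw [fderiv_linear_apply (S := fun q v => D.g q v y) (fun q => D.g_linear_left q y)
    (fun v => D.g_differentiableAt hp v y) hY u, D.compat p hp]

lemma Riem_contDiffOn (v w z : E n) : ContDiffOn ℝ (⊤ : ℕ∞) (fun q => D.Riem q v w z) D.U :=
  (((contDiffOn_fderiv_apply D.hU (D.Γ_smooth w z) v).sub
    (contDiffOn_fderiv_apply D.hU (D.Γ_smooth v z) w)).add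
    (D.contDiffOn_Γ_apply v (D.Γ_smooth w z))).sub (D.contDiffOn_Γ_apply w (D.Γ_smooth v z))

lemma Riem_differentiableAt (hp : p ∈ D.U) (v w z : E n) :
    DifferentiableAt ℝ (fun q => D.Riem q v w z) p :=
  differentiableAt_of_contDiffOn D.hU (D.Riem_contDiffOn v w z) hp

lemma Riem_swap (p v w z : E n) : D.Riem p w v z = -D.Riem p v w z := by
  simp only [Riem]; abel

lemma Riem_linear₁ (hp : p ∈ D.U) (w z : E n) : IsLinearMap ℝ fun v => D.Riem p v w z := by
  refine isLinearMap_of_smul_add fun a v v' => ?_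
  have h₁ : fderiv ℝ (fun q => D.Γ q (a • v + v') z) p w
      = a • fderiv ℝ (fun q => D.Γ q v z) p w + fderiv ℝ (fun q => D.Γ q v' z) p w :=
    (D.dΓ_linear_left hp w z).map_smul_add a v v'
  have h₂ := (D.Γ_linear_right p w).map_smul_add a (D.Γ p v z) (D.Γ p v' z)
  simp only [Riem, h₁]
  simp only [D.Γ_lin, h₂, map_add, map_smul]
  module

lemma Riem_linear₂ (hp : p ∈ D.U) (v z : E n) : IsLinearMap ℝ fun w => D.Riem p v w z := by
  simp_rw [fun w => D.Riem_swap p w v z]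
  exact ((-(D.Riem_linear₁ hp v z).mk' _ : E n →ₗ[ℝ] E n)).isLinear

lemma Riem_linear₃ (hp : p ∈ D.U) (v w : E n) : IsLinearMap ℝ fun z => D.Riem p v w z := by
  refine isLinearMap_of_smul_add fun a z z' => ?_
  have h : ∀ x y, fderiv ℝ (fun q => D.Γ q x (a • z + z')) p y
      = a • fderiv ℝ (fun q => D.Γ q x z) p y + fderiv ℝ (fun q => D.Γ q x z') p y := by
    exact fun x y => (D.dΓ_linear_right hp y x).map_smul_add a z z'
  have h' : ∀ x s t, D.Γ p x (a • s + t) = a • D.Γ p x s + D.Γ p x t := by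
    exact fun x s t => (D.Γ_linear_right p x).map_smul_add a s t
  simp only [Riem, h, h']
  module

/-- The curvature endomorphism `R(v,w)` is skew-adjoint. -/
lemma g_Riem_skew (hp : p ∈ D.U) (v w z y : E n) :
    D.g p (D.Riem p v w z) y + D.g p (D.Riem p v w y) z = 0 := by
  have key : ∀ v w, fderiv ℝ (fun q => fderiv ℝ (fun r => D.g r z y) q w) p v
      = D.g p (D.Γ p v (D.Γ p w z)) y + D.g p (D.Γ p w z) (D.Γ p v y)
        + D.g p (fderiv ℝ (fun q => D.Γ q w z) p v) y
        + (D.g p (D.Γ p v (D.Γ p w y)) z + D.g p (D.Γ p w y) (D.Γ p v z)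
        + D.g p (fderiv ℝ (fun q => D.Γ q w y) p v) z) := by
    intro v w
    have he : (fun q => fderiv ℝ (fun r => D.g r z y) q w) =ᶠ[nhds p]
        fun q => D.g q (D.Γ q w z) y + D.g q (D.Γ q w y) z := by
      filter_upwards [D.hU.mem_nhds hp] with q hq
      rw [D.compat q hq, D.g_symm q z]
    rw [he.fderiv_eq,
      fderiv_fun_add (D.differentiableAt_g_apply hp y (D.Γ_differentiableAt hp w z))
        (D.differentiableAt_g_apply hp z (D.Γ_differentiableAt hp w y)),
      add_apply, D.fderiv_g_apply hp y (D.Γ_differentiableAt hp w z),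
      D.fderiv_g_apply hp z (D.Γ_differentiableAt hp w y)]
  have hc := fderiv_fderiv_comm D.hU (D.g_smooth z y) hp v w
  rw [key, key] at hc
  simp only [Riem, g_add_left, g_sub_left]
  linarith [D.g_symm p (D.Γ p w y) (D.Γ p v z), D.g_symm p (D.Γ p v y) (D.Γ p w z)]

/-- The covariant derivative `(∇_u R)(v,w)z` of the curvature tensor. -/
def covDerivRiem (p u v w z : E n) : E n :=
  fderiv ℝ (fun q => D.Riem q v w z) p u + D.Γ p u (D.Riem p v w z)
    - D.Riem p (D.Γ p u v) w z - D.Riem p v (D.Γ p u w) z - D.Riem p v w (D.Γ p u z)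

lemma fderiv_Riem (hp : p ∈ D.U) (u v w z : E n) :
    fderiv ℝ (fun q => D.Riem q v w z) p u
      = fderiv ℝ (fun q => fderiv ℝ (fun r => D.Γ r w z) q v) p u
        - fderiv ℝ (fun q => fderiv ℝ (fun r => D.Γ r v z) q w) p u
        + (fderiv ℝ (fun q => D.Γ q v (D.Γ p w z)) p u
          + D.Γ p v (fderiv ℝ (fun q => D.Γ q w z) p u))
        - (fderiv ℝ (fun q => D.Γ q w (D.Γ p v z)) p u
          + D.Γ p w (fderiv ℝ (fun q => D.Γ q v z) p u)) := by
  have d {h : E n → E n} (hh : ContDiffOn ℝ (⊤ : ℕ∞) h D.U) : DifferentiableAt ℝ h p :=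
    differentiableAt_of_contDiffOn D.hU hh hp
  have d₁ := d (contDiffOn_fderiv_apply D.hU (D.Γ_smooth w z) v)
  have d₂ := d (contDiffOn_fderiv_apply D.hU (D.Γ_smooth v z) w)
  have d₃ := d (D.contDiffOn_Γ_apply v (D.Γ_smooth w z))
  have d₄ := d (D.contDiffOn_Γ_apply w (D.Γ_smooth v z))
  simp only [Riem]
  rw [fderiv_fun_sub ((d₁.fun_sub d₂).fun_add d₃) d₄, fderiv_fun_add (d₁.fun_sub d₂) d₃,
    fderiv_fun_sub d₁ d₂]
  simp only [add_apply, sub_apply]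
  rw [D.fderiv_Γ_apply hp v (D.Γ_differentiableAt hp w z),
    D.fderiv_Γ_apply hp w (D.Γ_differentiableAt hp v z)]

lemma covDerivRiem_swap (p u v w z : E n) :
    D.covDerivRiem p u w v z = -D.covDerivRiem p u v w z := by
  simp only [covDerivRiem, fun q => D.Riem_swap q v w z, D.Riem_swap p (D.Γ p u v) w z,
    D.Riem_swap p v (D.Γ p u w) z, D.Riem_swap p v w (D.Γ p u z), fderiv_fun_neg,
    neg_apply, (D.Γ_linear_right p u).map_neg]
  abel

/-- The second Bianchi identity. -/
lemma second_bianchi (hp : p ∈ D.U) (u v w z : E n) :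
    D.covDerivRiem p u v w z + D.covDerivRiem p v w u z + D.covDerivRiem p w u v z = 0 := by
  simp only [covDerivRiem, D.fderiv_Riem hp, D.Γ_symm p v u, D.Γ_symm p w u, D.Γ_symm p w v]
  rw [D.Riem_swap p (D.Γ p u v) w, D.Riem_swap p (D.Γ p v w) u, D.Riem_swap p v (D.Γ p u w)]
  rw [fderiv_fderiv_comm D.hU (D.Γ_smooth w z) hp u v,
    fderiv_fderiv_comm D.hU (D.Γ_smooth v z) hp u w,
    fderiv_fderiv_comm D.hU (D.Γ_smooth u z) hp v w]
  simp only [Riem, Γ_add_right, Γ_sub_right]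
  abel

/-- The covariant derivative of the curvature endomorphism is skew-adjoint. -/
lemma g_covDerivRiem_skew (hp : p ∈ D.U) (u v w z y : E n) :
    D.g p (D.covDerivRiem p u v w z) y + D.g p (D.covDerivRiem p u v w y) z = 0 := by
  have he : (fun q => D.g q (D.Riem q v w z) y + D.g q (D.Riem q v w y) z) =ᶠ[nhds p]
      fun _ => 0 := by
    filter_upwards [D.hU.mem_nhds hp] with q hq using D.g_Riem_skew hq v w z y
  have hd := congrArg (fun L : E n →L[ℝ] ℝ => L u) he.fderiv_eq
  simp only [fderiv_fun_const] at hd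
  rw [fderiv_fun_add (D.differentiableAt_g_apply hp y (D.Riem_differentiableAt hp v w z))
      (D.differentiableAt_g_apply hp z (D.Riem_differentiableAt hp v w y)),
    add_apply, D.fderiv_g_apply hp y (D.Riem_differentiableAt hp v w z),
    D.fderiv_g_apply hp z (D.Riem_differentiableAt hp v w y)] at hd
  simp only [Pi.zero_apply, zero_apply] at hd
  simp only [covDerivRiem, g_add_left, g_sub_left]
  linarith [D.g_Riem_skew hp (D.Γ p u v) w z y, D.g_Riem_skew hp v (D.Γ p u w) z y,
    D.g_Riem_skew hp v w (D.Γ p u z) y, D.g_Riem_skew hp v w z (D.Γ p u y)]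

end Basic

section Ricci

variable {n : ℕ} (D : RiemannChart n) {p : E n}

lemma Ric_contDiffOn (v w : E n) : ContDiffOn ℝ (⊤ : ℕ∞) (fun q => D.Ric q v w) D.U :=
  ContDiffOn.sum fun i _ => (EuclideanSpace.proj i : E n →L[ℝ] ℝ).contDiff.comp_contDiffOn
    (D.Riem_contDiffOn (e n i) v w)

lemma Ric_linear_left (hp : p ∈ D.U) (w : E n) : IsLinearMap ℝ fun v => D.Ric p v w := by
  refine isLinearMap_of_smul_add fun a v v' => ?_
  simp only [Ric, fun i => (D.Riem_linear₂ hp (e n i) w).map_smul_add a v v']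
  simp [Finset.sum_add_distrib, Finset.mul_sum]

lemma Ric_linear_right (hp : p ∈ D.U) (v : E n) : IsLinearMap ℝ fun w => D.Ric p v w := by
  refine isLinearMap_of_smul_add fun a w w' => ?_
  simp only [Ric, fun i => (D.Riem_linear₃ hp (e n i) v).map_smul_add a w w']
  simp [Finset.sum_add_distrib, Finset.mul_sum]

lemma covDeriv2_Ric (hp : p ∈ D.U) (u v w : E n) :
    D.covDeriv2 D.Ric p u v w = ∑ i, D.covDerivRiem p u (e n i) v w i := by
  have hd : fderiv ℝ (fun q => D.Ric q v w) p u
      = ∑ i, fderiv ℝ (fun q => D.Riem q (e n i) v w) p u i := by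
    have hR := fun i => D.Riem_differentiableAt hp (e n i) v w
    simp only [Ric]
    rw [fderiv_fun_sum fun i _ => (hasFDerivAt_coord (hR i) i).differentiableAt]
    simp [fderiv_coord (hR _)]
  have ht := sum_comp_apply_comm (D.Γ_linear_right p u) (D.Riem_linear₁ hp v w)
  simp only [covDeriv2, hd]
  simp only [covDerivRiem, PiLp.add_apply, PiLp.sub_apply,
    Finset.sum_add_distrib, Finset.sum_sub_distrib, ht, Ric]
  ring

end Ricci

section InverseMetric

variable {n : ℕ} (D : RiemannChart n) {p : E n}

lemma sum_ginv_mul_g (hp : p ∈ D.U) (i : Fin n) (w : E n) :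
    ∑ k, D.ginv p (e n i) (e n k) * D.g p (e n k) w = w i := by
  simp_rw [fun k => (D.g_linear_right p (e n k)).eq_sum_e w, Finset.mul_sum]
  rw [Finset.sum_comm]
  have : ∀ j, ∑ k, D.ginv p (e n i) (e n k) * (w j • D.g p (e n k) (e n j))
      = w j * if i = j then 1 else 0 := by
    intro j
    rw [← D.ginv_g p hp i j, Finset.mul_sum]
    exact Finset.sum_congr rfl fun k _ => by simp only [smul_eq_mul]; ring
  rw [Finset.sum_congr rfl fun j _ => this j]
  simp

lemma det_contDiffOn {m : ℕ} {A : E n → Matrix (Fin m) (Fin m) ℝ} {U : Set (E n)}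
    (hA : ∀ i j, ContDiffOn ℝ (⊤ : ℕ∞) (fun q => A q i j) U) :
    ContDiffOn ℝ (⊤ : ℕ∞) (fun q => (A q).det) U := by
  simp_rw [Matrix.det_apply]
  exact ContDiffOn.sum fun σ _ => (contDiffOn_prod fun i _ => hA _ _).const_smul _

lemma ginv_contDiffOn (i j : Fin n) :
    ContDiffOn ℝ (⊤ : ℕ∞) (fun q => D.ginv q (e n i) (e n j)) D.U := by
  let G : E n → Matrix (Fin n) (Fin n) ℝ := fun q => Matrix.of fun i j => D.g q (e n i) (e n j)
  have hG : ∀ i j, ContDiffOn ℝ (⊤ : ℕ∞) (fun q => G q i j) D.U := fun i j => D.g_smooth _ _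
  have hleft : ∀ q ∈ D.U, (Matrix.of fun i j => D.ginv q (e n i) (e n j)) * G q = 1 := by
    intro q hq
    ext a b
    simpa [Matrix.mul_apply, Matrix.one_apply, G] using D.ginv_g q hq a b
  have hdet : ∀ q ∈ D.U, (G q).det ≠ 0 := fun q hq h0 => by
    simpa [h0] using congrArg Matrix.det (hleft q hq)
  have hadj : ContDiffOn ℝ (⊤ : ℕ∞) (fun q => (G q).adjugate i j) D.U := by
    simp_rw [Matrix.adjugate_apply]
    refine det_contDiffOn fun a b => ?_
    by_cases h : a = j
    · subst h
      simpa using contDiffOn_const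
    · simpa [Matrix.updateRow_ne h] using hG a b
  refine (((det_contDiffOn hG).inv hdet).mul hadj).congr fun q hq => ?_
  have := congrFun (congrFun (Matrix.inv_eq_left_inv (hleft q hq)) i) j
  rw [Matrix.inv_def, Ring.inverse_eq_inv'] at this
  simpa using this.symm

lemma ginv_differentiableAt (hp : p ∈ D.U) (i j : Fin n) :
    DifferentiableAt ℝ (fun q => D.ginv q (e n i) (e n j)) p :=
  differentiableAt_of_contDiffOn D.hU (D.ginv_contDiffOn i j) hp

/-- The inverse metric is parallel. -/
lemma fderiv_ginv (hp : p ∈ D.U) (v : E n) (i l : Fin n) :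
    fderiv ℝ (fun q => D.ginv q (e n i) (e n l)) p v
      = -(∑ k, D.ginv p (e n i) (e n k) * D.Γ p v (e n k) l
        + ∑ k, D.ginv p (e n k) (e n l) * D.Γ p v (e n k) i) := by
  have hrow : ∀ j, ∑ k, fderiv ℝ (fun q => D.ginv q (e n i) (e n k)) p v * D.g p (e n k) (e n j)
      = -(∑ k, D.ginv p (e n i) (e n k) * D.g p (D.Γ p v (e n k)) (e n j)
          + D.Γ p v (e n j) i) := by
    intro j
    have he : (fun q => ∑ k, D.ginv q (e n i) (e n k) * D.g q (e n k) (e n j)) =ᶠ[nhds p]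
        fun _ => if i = j then 1 else 0 := by
      filter_upwards [D.hU.mem_nhds hp] with q hq using D.ginv_g q hq i j
    have hd := congrArg (fun L : E n →L[ℝ] ℝ => L v) he.fderiv_eq
    simp only [fderiv_fun_const] at hd
    rw [fderiv_fun_sum fun k _ =>
      (D.ginv_differentiableAt hp i k).fun_mul (D.g_differentiableAt hp _ _)] at hd
    simp only [fderiv_fun_mul (D.ginv_differentiableAt hp i _) (D.g_differentiableAt hp _ _),
      sum_apply, add_apply, smul_apply, smul_eq_mul, D.compat p hp, Finset.sum_add_distrib,
      mul_add, D.sum_ginv_mul_g hp, Pi.zero_apply, zero_apply] at hd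
    simp only [mul_comm (fderiv ℝ _ p v)]
    linarith
  have hcol : ∀ w : E n, ∑ j, D.g p w (e n j) * D.ginv p (e n j) (e n l) = w l := by
    intro w
    rw [← D.sum_ginv_mul_g hp l w]
    exact Finset.sum_congr rfl fun j _ => by rw [D.g_symm, D.ginv_symm, mul_comm]
  have hsum := Finset.sum_congr (rfl : Finset.univ = Finset.univ)
    fun j (_ : j ∈ Finset.univ) => congrArg (· * D.ginv p (e n j) (e n l)) (hrow j)
  simp only [neg_mul, add_mul, Finset.sum_mul, Finset.sum_neg_distrib, Finset.sum_add_distrib]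
    at hsum
  rw [Finset.sum_comm, Finset.sum_comm (f := fun j k => _ * D.g p (D.Γ p v (e n k)) _ * _)] at hsum
  simp only [mul_assoc, ← Finset.mul_sum, hcol] at hsum
  simp only [e, EuclideanSpace.single, PiLp.single_apply, mul_ite, mul_one, mul_zero,
    Finset.sum_ite_eq, Finset.mem_univ, if_true] at hsum ⊢
  rw [hsum]
  simp only [mul_comm]

/-- Taking the metric trace commutes with covariant differentiation. -/
lemma fderiv_trace {T : E n → E n → E n → ℝ} (hp : p ∈ D.U)
    (hT : ∀ v w, DifferentiableAt ℝ (fun q => T q v w) p)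
    (hl : ∀ w, IsLinearMap ℝ fun v => T p v w) (hr : ∀ v, IsLinearMap ℝ fun w => T p v w)
    (v : E n) :
    fderiv ℝ (fun q => ∑ i, ∑ j, D.ginv q (e n i) (e n j) * T q (e n i) (e n j)) p v
      = ∑ i, ∑ j, D.ginv p (e n i) (e n j) * D.covDeriv2 T p v (e n i) (e n j) := by
  have hm := fun i j => (D.ginv_differentiableAt hp i j).fun_mul (hT (e n i) (e n j))
  rw [fderiv_fun_sum fun i _ => DifferentiableAt.fun_sum fun j _ => hm i j]
  simp only [fun i => fderiv_fun_sum fun j (_ : j ∈ Finset.univ) => hm i j, sum_apply,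
    fderiv_fun_mul (D.ginv_differentiableAt hp _ _) (hT _ _), add_apply, smul_apply, smul_eq_mul,
    D.fderiv_ginv hp, covDeriv2]
  simp only [fun w i => (hl w).eq_sum_e (D.Γ p v (e n i)),
    fun w j => (hr w).eq_sum_e (D.Γ p v (e n j)), smul_eq_mul, mul_sub, mul_neg, mul_add,
    Finset.sum_add_distrib, Finset.sum_sub_distrib, Finset.sum_neg_distrib, Finset.mul_sum]
  have h₁ : ∑ i, ∑ j, ∑ k, T p (e n i) (e n j) * (D.ginv p (e n i) (e n k) * D.Γ p v (e n k) j)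
      = ∑ i, ∑ j, ∑ k, D.ginv p (e n i) (e n j) * (D.Γ p v (e n j) k * T p (e n i) (e n k)) := by
    refine Finset.sum_congr rfl fun i _ => ?_
    rw [Finset.sum_comm]
    exact Finset.sum_congr rfl fun j _ => Finset.sum_congr rfl fun k _ => by ring
  have h₂ : ∑ i, ∑ j, ∑ k, T p (e n i) (e n j) * (D.ginv p (e n k) (e n j) * D.Γ p v (e n k) i)
      = ∑ i, ∑ j, ∑ k, D.ginv p (e n i) (e n j) * (D.Γ p v (e n i) k * T p (e n k) (e n j)) := by
    rw [Finset.sum_comm, Finset.sum_comm (γ := Fin n) (f := fun i j => ∑ k, D.ginv p (e n i) _ * _)]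
    refine Finset.sum_congr rfl fun j _ => ?_
    rw [Finset.sum_comm]
    exact Finset.sum_congr rfl fun i _ => Finset.sum_congr rfl fun k _ => by ring
  linarith

lemma scalar_contDiffOn : ContDiffOn ℝ (⊤ : ℕ∞) D.scalar D.U :=
  ContDiffOn.sum fun i _ => ContDiffOn.sum fun j _ =>
    (D.ginv_contDiffOn i j).mul (D.Ric_contDiffOn _ _)

end InverseMetric

section OrthonormalFrame

variable {n : ℕ} (D : RiemannChart n) {p : E n}

lemma exists_orthonormal_frame (hp : p ∈ D.U) :
    ∃ b : Fin n → E n, (∀ i j, D.g p (b i) (b j) = if i = j then 1 else 0) ∧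
      ∀ v, v = ∑ i, D.g p v (b i) • b i := by
  let B : LinearMap.BilinForm ℝ (E n) := LinearMap.mk₂ ℝ (D.g p)
    (fun u v w => (D.g_linear_left p w).map_add u v)
    (fun a u w => (D.g_linear_left p w).map_smul a u)
    (fun w u v => (D.g_linear_right p w).map_add u v)
    (fun a w u => (D.g_linear_right p w).map_smul a u)
  have hB : ∀ v w, B v w = D.g p v w := fun v w => rfl
  obtain ⟨c', hc'⟩ := LinearMap.BilinForm.exists_orthogonal_basis (B := B)
    ⟨fun v w => D.g_symm p v w⟩
  let σ : Fin (Module.finrank ℝ (E n)) ≃ Fin n := finCongr (by simp)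
  let c := c'.reindex σ
  have hc : ∀ i j, i ≠ j → D.g p (c i) (c j) = 0 := by
    intro i j hij
    have := hc' (σ.symm.injective.ne hij)
    simpa [c, hB] using this
  have hpos : ∀ i, 0 < D.g p (c i) (c i) := fun i => D.g_posdef p hp _ (c.ne_zero i)
  let r : Fin n → ℝ := fun i => (Real.sqrt (D.g p (c i) (c i)))⁻¹
  have hr : ∀ i, r i * r i * D.g p (c i) (c i) = 1 := by
    intro i
    have h := Real.mul_self_sqrt (hpos i).le
    have h' : Real.sqrt (D.g p (c i) (c i)) ≠ 0 := (Real.sqrt_pos.2 (hpos i)).ne'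
    simp only [r]
    field_simp
    linarith
  have hsl : ∀ a v w, D.g p (a • v) w = a * D.g p v w :=
    fun a v w => (D.g_linear_left p w).map_smul a v
  have hsr : ∀ a v w, D.g p v (a • w) = a * D.g p v w :=
    fun a v w => (D.g_linear_right p v).map_smul a w
  refine ⟨fun i => r i • c i, fun i j => ?_, fun v => ?_⟩
  · rw [hsl, hsr, ← mul_assoc]
    split_ifs with h
    · subst h; exact hr i
    · rw [hc i j h, mul_zero]
  · have hv : ∀ i, D.g p v (c i) = c.repr v i * D.g p (c i) (c i) := by
      intro i
      conv_lhs => rw [← c.sum_repr v, (D.g_linear_left p (c i)).map_sum_smul]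
      rw [Finset.sum_eq_single i]
      · rfl
      · intro j _ hj; rw [hc j i hj, smul_zero]
      · simp
    conv_lhs => rw [← c.sum_repr v]
    refine Finset.sum_congr rfl fun i _ => ?_
    rw [hsr, hv, smul_smul]
    congr 1
    linear_combination -(c.repr v i) * hr i

variable {D} {b : Fin n → E n}

lemma sum_apply_e_eq_frame (hexp : ∀ v, v = ∑ i, D.g p v (b i) • b i)
    {L : E n → E n} (hL : IsLinearMap ℝ L) :
    ∑ i, L (e n i) i = ∑ k, D.g p (L (b k)) (b k) := by
  have h : ∀ i, L (e n i) i = ∑ k, L (b k) i * D.g p (e n i) (b k) := by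
    intro i
    conv_lhs => rw [hexp (e n i), hL.map_sum_smul]
    simp [Finset.sum_apply, mul_comm]
  simp_rw [h, fun k => (D.g_linear_left p (b k)).eq_sum_e (L (b k)), smul_eq_mul]
  exact Finset.sum_comm

lemma sum_ginv_mul_eq_frame (hexp : ∀ v, v = ∑ i, D.g p v (b i) • b i)
    (hp : p ∈ D.U) {B : E n → E n → ℝ}
    (hl : ∀ w, IsLinearMap ℝ fun v => B v w) (hr : ∀ v, IsLinearMap ℝ fun w => B v w) :
    ∑ i, ∑ j, D.ginv p (e n i) (e n j) * B (e n i) (e n j) = ∑ k, B (b k) (b k) := by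
  have h : ∀ i, ∑ j, D.ginv p (e n i) (e n j) * B (e n i) (e n j)
      = ∑ k, b k i * B (e n i) (b k) := by
    intro i
    have h' : ∀ j, B (e n i) (e n j) = ∑ k, D.g p (e n j) (b k) * B (e n i) (b k) := by
      intro j
      conv_lhs => rw [hexp (e n j), (hr (e n i)).map_sum_smul]
      rfl
    simp_rw [h', Finset.mul_sum]
    rw [Finset.sum_comm]
    simp_rw [← mul_assoc, ← Finset.sum_mul, D.sum_ginv_mul_g hp]
  simp_rw [h]
  rw [Finset.sum_comm]
  exact Finset.sum_congr rfl fun k _ => ((hl (b k)).eq_sum_e (b k)).symm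

end OrthonormalFrame

section Soliton

variable {n : ℕ} {D : RiemannChart n} {f : E n → ℝ} {lam : ℝ} {p : E n}

lemma fderiv_linear {F : Type*} [NormedAddCommGroup F] [NormedSpace ℝ F] {U : Set (E n)}
    (hU : IsOpen U) (hp : p ∈ U) {S : E n → E n → F} (hS : ∀ q ∈ U, IsLinearMap ℝ (S q))
    (hd : ∀ v, DifferentiableAt ℝ (fun q => S q v) p) (u : E n) :
    IsLinearMap ℝ fun v => fderiv ℝ (fun q => S q v) p u := by
  refine isLinearMap_of_smul_add fun a v w => ?_
  have he : (fun q => S q (a • v + w)) =ᶠ[nhds p] fun q => a • S q v + S q w := by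
    filter_upwards [hU.mem_nhds hp] with q hq using (hS q hq).map_smul_add a v w
  rw [he.fderiv_eq, fderiv_fun_add ((hd v).fun_const_smul a) (hd w), fderiv_fun_const_smul (hd v)]
  simp

lemma covDerivRiem_linear₂ (hp : p ∈ D.U) (u w z : E n) :
    IsLinearMap ℝ fun v => D.covDerivRiem p u v w z := by
  refine isLinearMap_of_smul_add fun a v v' => ?_
  have h := (fderiv_linear D.hU hp (S := fun q v => D.Riem q v w z)
    (fun q hq => D.Riem_linear₁ hq w z) (fun v => D.Riem_differentiableAt hp v w z)
    u).map_smul_add a v v'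
  simp only [covDerivRiem, h, fun x y => (D.Riem_linear₁ hp x y).map_smul_add a,
    fun x => (D.Γ_linear_right p x).map_smul_add a]
  module

lemma covDerivRiem_linear₃ (hp : p ∈ D.U) (u v z : E n) :
    IsLinearMap ℝ fun w => D.covDerivRiem p u v w z := by
  simp_rw [fun w => D.covDerivRiem_swap p u w v z]
  exact (-(covDerivRiem_linear₂ hp u v z).mk' _ : E n →ₗ[ℝ] E n).isLinear

lemma covDerivRiem_linear₄ (hp : p ∈ D.U) (u v w : E n) :
    IsLinearMap ℝ fun z => D.covDerivRiem p u v w z := by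
  refine isLinearMap_of_smul_add fun a z z' => ?_
  have h := (fderiv_linear D.hU hp (S := fun q z => D.Riem q v w z)
    (fun q hq => D.Riem_linear₃ hq v w) (fun z => D.Riem_differentiableAt hp v w z)
    u).map_smul_add a z z'
  simp only [covDerivRiem, h, fun x y => (D.Riem_linear₃ hp x y).map_smul_add a,
    fun x => (D.Γ_linear_right p x).map_smul_add a]
  module

lemma covDeriv2_Ric_linear_left (hp : p ∈ D.U) (u w : E n) :
    IsLinearMap ℝ fun v => D.covDeriv2 D.Ric p u v w := by
  refine isLinearMap_of_smul_add fun a v v' => ?_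
  simp only [D.covDeriv2_Ric hp, (covDerivRiem_linear₃ hp u _ w).map_smul_add a v v']
  simp [Finset.sum_add_distrib, Finset.mul_sum]

lemma covDeriv2_Ric_linear_right (hp : p ∈ D.U) (u v : E n) :
    IsLinearMap ℝ fun w => D.covDeriv2 D.Ric p u v w := by
  refine isLinearMap_of_smul_add fun a w w' => ?_
  simp only [D.covDeriv2_Ric hp, (covDerivRiem_linear₄ hp u _ v).map_smul_add a w w']
  simp [Finset.sum_add_distrib, Finset.mul_sum]

lemma fderiv_scalar {b : Fin n → E n} (hexp : ∀ v, v = ∑ i, D.g p v (b i) • b i) (hp : p ∈ D.U)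
    (u : E n) : fderiv ℝ D.scalar p u = ∑ l, D.covDeriv2 D.Ric p u (b l) (b l) := by
  rw [← sum_ginv_mul_eq_frame hexp hp (covDeriv2_Ric_linear_left hp u)
    (covDeriv2_Ric_linear_right hp u)]
  exact D.fderiv_trace hp
    (fun v w => differentiableAt_of_contDiffOn D.hU (D.Ric_contDiffOn v w) hp)
    (D.Ric_linear_left hp) (D.Ric_linear_right hp) u

/-- The twice contracted second Bianchi identity, in an orthonormal frame at `p`. -/
lemma contracted_second_bianchi {b : Fin n → E n}
    (hexp : ∀ v, v = ∑ i, D.g p v (b i) • b i) (hp : p ∈ D.U) (u : E n) :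
    fderiv ℝ D.scalar p u = 2 * ∑ l, D.covDeriv2 D.Ric p (b l) u (b l) := by
  have hRic : ∀ x v w, D.covDeriv2 D.Ric p x v w
      = ∑ k, D.g p (D.covDerivRiem p x (b k) v w) (b k) := fun x v w => by
    rw [D.covDeriv2_Ric hp, sum_apply_e_eq_frame hexp (covDerivRiem_linear₂ hp x v w)]
  have hB : ∀ l k, D.g p (D.covDerivRiem p u (b k) (b l) (b l)) (b k)
      = D.g p (D.covDerivRiem p (b l) (b k) u (b l)) (b k)
        + D.g p (D.covDerivRiem p (b k) (b l) u (b k)) (b l) := by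
    intro l k
    have h := congrArg (fun x => D.g p x (b k)) (D.second_bianchi hp u (b k) (b l) (b l))
    simp only [g_add_left, (D.g_linear_left p (b k)).map_zero,
      D.covDerivRiem_swap p (b l) (b k) u, g_neg_left] at h
    linarith [D.g_covDerivRiem_skew hp (b k) (b l) u (b l) (b k)]
  rw [fderiv_scalar hexp hp]
  simp only [hRic, hB, Finset.sum_add_distrib]
  rw [Finset.sum_comm (f := fun l k => D.g p (D.covDerivRiem p (b k) (b l) u (b k)) (b l))]
  ring

/-- The Ricci identity for the differential of a function. -/
lemma covDeriv2_Hess_sub (hf : ContDiffOn ℝ (⊤ : ℕ∞) f D.U) (hp : p ∈ D.U) (v w z : E n) :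
    D.covDeriv2 (D.Hess f) p v w z - D.covDeriv2 (D.Hess f) p w v z
      = -fderiv ℝ f p (D.Riem p v w z) := by
  have hdf : ∀ x, DifferentiableAt ℝ (fun q => fderiv ℝ f q x) p := fun x =>
    differentiableAt_of_contDiffOn D.hU (contDiffOn_fderiv_apply D.hU hf x) hp
  have hdd : ∀ x y, DifferentiableAt ℝ (fun q => fderiv ℝ (fun r => fderiv ℝ f r y) q x) p :=
    fun x y => differentiableAt_of_contDiffOn D.hU (contDiffOn_fderiv_apply D.hU
      (contDiffOn_fderiv_apply D.hU hf y) x) hp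
  have hlin : ∀ q, IsLinearMap ℝ fun x => fderiv ℝ f q x := fun q => (fderiv ℝ f q).isLinear
  have key : ∀ v w, fderiv ℝ (fun q => D.Hess f q w z) p v
      = fderiv ℝ (fun q => fderiv ℝ (fun r => fderiv ℝ f r z) q w) p v
        - (fderiv ℝ (fun q => fderiv ℝ f q (D.Γ p w z)) p v
          + fderiv ℝ f p (fderiv ℝ (fun q => D.Γ q w z) p v)) := by
    intro v w
    simp only [Hess]
    rw [fderiv_fun_sub (hdd w z)
      (differentiableAt_linear_apply hlin hdf (D.Γ_differentiableAt hp w z)), sub_apply,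
      fderiv_linear_apply hlin hdf (D.Γ_differentiableAt hp w z)]
  simp only [covDeriv2, key]
  simp only [Hess, Riem, D.Γ_symm p w v, map_add, map_sub]
  rw [fderiv_fderiv_comm D.hU (contDiffOn_fderiv_apply D.hU hf z) hp v w,
    fderiv_fderiv_comm D.hU hf hp v (D.Γ p w z), fderiv_fderiv_comm D.hU hf hp w (D.Γ p v z)]
  ring

lemma Hess_symm (hf : ContDiffOn ℝ (⊤ : ℕ∞) f D.U) (hp : p ∈ D.U) (v w : E n) :
    D.Hess f p v w = D.Hess f p w v := by
  rw [Hess, Hess, fderiv_fderiv_comm D.hU hf hp, D.Γ_symm]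

lemma Ric_symm_of_soliton (hsol : D.IsGradientSoliton f lam) (hp : p ∈ D.U) (v w : E n) :
    D.Ric p v w = D.Ric p w v := by
  linear_combination hsol.2 p hp v w - hsol.2 p hp w v - Hess_symm hsol.1 hp v w
    + lam * D.g_symm p v w

/-- On a gradient soliton, `(∇_v Ric)(w,z) - (∇_w Ric)(v,z) = df(R(v,w)z)`. -/
lemma covDeriv2_Ric_sub (hsol : D.IsGradientSoliton f lam) (hp : p ∈ D.U) (v w z : E n) :
    D.covDeriv2 D.Ric p v w z - D.covDeriv2 D.Ric p w v z = fderiv ℝ f p (D.Riem p v w z) := by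
  have hRic : ∀ q ∈ D.U, ∀ x y, D.Hess f q x y = lam * D.g q x y - D.Ric q x y :=
    fun q hq x y => by linarith [hsol.2 q hq x y]
  have key : ∀ v w, D.covDeriv2 (D.Hess f) p v w z = -D.covDeriv2 D.Ric p v w z := by
    intro v w
    have he : (fun q => D.Hess f q w z) =ᶠ[nhds p] fun q => lam * D.g q w z - D.Ric q w z := by
      filter_upwards [D.hU.mem_nhds hp] with q hq using hRic q hq w z
    simp only [covDeriv2, hRic p hp, he.fderiv_eq]
    rw [fderiv_fun_sub ((D.g_differentiableAt hp w z).const_mul lam)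
      (differentiableAt_of_contDiffOn D.hU (D.Ric_contDiffOn w z) hp),
      fderiv_const_mul (D.g_differentiableAt hp w z)]
    simp only [sub_apply, smul_apply, smul_eq_mul, D.compat p hp]
    ring
  have := covDeriv2_Hess_sub hsol.1 hp v w z
  rw [key, key] at this
  linarith

end Soliton

section ThreeDimensional

/-- The algebraic identity behind the Codazzi equation: in dimension three an algebraic curvature
tensor is determined by its Ricci contraction. -/
lemma curvature_identity_three {R : Fin 3 → Fin 3 → Fin 3 → Fin 3 → ℝ} (φ : Fin 3 → ℝ)
    (h₁ : ∀ i j k l, R j i k l = -R i j k l) (h₂ : ∀ i j k l, R i j l k = -R i j k l)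
    (hs : ∀ i j, ∑ k, R k i j k = ∑ k, R k j i k) (i j k : Fin 3) :
    ∑ l, R i j k l * φ l
      - ((∑ l, ∑ m, R i l l m * φ m) * (if j = k then 1 else 0)
        - (∑ l, ∑ m, R j l l m * φ m) * (if i = k then 1 else 0))
      - φ i * (∑ m, R m j k m - (∑ l, ∑ m, R m l l m) / 2 * if j = k then 1 else 0)
      + φ j * (∑ m, R m i k m - (∑ l, ∑ m, R m l l m) / 2 * if i = k then 1 else 0) = 0 := by
  have z₁ : ∀ i k l, R i i k l = 0 := fun i k l => by linarith [h₁ i i k l]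
  have z₂ : ∀ i j k, R i j k k = 0 := fun i j k => by linarith [h₂ i j k k]
  have a₁ := fun k l => h₁ 0 1 k l
  have a₂ := fun k l => h₁ 0 2 k l
  have a₃ := fun k l => h₁ 1 2 k l
  have b₁ := fun i j => h₂ i j 0 1
  have b₂ := fun i j => h₂ i j 0 2
  have b₃ := fun i j => h₂ i j 1 2
  have s₁ := hs 0 1
  have s₂ := hs 0 2
  have s₃ := hs 1 2
  simp only [Fin.sum_univ_three, z₁, z₂, a₁, a₂, a₃, b₁, b₂, b₃] at s₁ s₂ s₃
  have t₁ : R 1 2 0 2 = R 0 2 1 2 := by linarith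
  have t₂ : R 1 2 0 1 = R 0 1 1 2 := by linarith
  have t₃ : R 0 2 0 1 = R 0 1 0 2 := by linarith
  fin_cases i <;> fin_cases j <;> fin_cases k <;>
    simp [Fin.sum_univ_three, z₁, z₂, a₁, a₂, a₃, b₁, b₂, b₃, t₁, t₂, t₃] <;> ring

variable {D : RiemannChart 3} {f : E 3 → ℝ} {lam : ℝ} {p : E 3}

/-- On a three-dimensional gradient soliton the curvature term `df(R(v,w)u)` is expressed
through the Ricci tensor and the differential of the scalar curvature. -/
lemma fderiv_Riem_eq_of_soliton (hsol : D.IsGradientSoliton f lam) (hp : p ∈ D.U) (v w u : E 3) :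
    fderiv ℝ f p (D.Riem p v w u)
      - (fderiv ℝ D.scalar p v * D.g p w u - fderiv ℝ D.scalar p w * D.g p v u) / 2
      - fderiv ℝ f p v * (D.Ric p w u - D.scalar p / 2 * D.g p w u)
      + fderiv ℝ f p w * (D.Ric p v u - D.scalar p / 2 * D.g p v u) = 0 := by
  obtain ⟨b, hb, hexp⟩ := D.exists_orthonormal_frame hp
  have hRic : ∀ x y, D.Ric p x y = ∑ k, D.g p (D.Riem p (b k) x y) (b k) := fun x y =>
    sum_apply_e_eq_frame hexp (D.Riem_linear₁ hp x y)
  have hscal : D.scalar p = ∑ l, D.Ric p (b l) (b l) :=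
    sum_ginv_mul_eq_frame hexp hp (D.Ric_linear_left hp) (D.Ric_linear_right hp)
  have hdf : ∀ x, fderiv ℝ f p x = ∑ l, D.g p x (b l) * fderiv ℝ f p (b l) := by
    intro x
    conv_lhs => rw [hexp x]
    simp
  have hds : ∀ x, fderiv ℝ D.scalar p x
      = 2 * ∑ l, ∑ m, D.g p (D.Riem p x (b l) (b l)) (b m) * fderiv ℝ f p (b m) := by
    intro x
    have h₁ := fderiv_scalar hexp hp x
    have h₂ := contracted_second_bianchi hexp hp x
    have h₃ := Finset.sum_congr (rfl : Finset.univ = Finset.univ)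
      fun l (_ : l ∈ Finset.univ) => covDeriv2_Ric_sub hsol hp x (b l) (b l)
    rw [Finset.sum_sub_distrib] at h₃
    simp_rw [← hdf]
    linarith
  revert v w u
  refine trilinear_eq_zero hexp (fun w u => ?_) (fun v u => ?_) (fun v w => ?_) fun i j k => ?_
  · refine isLinearMap_of_smul_add fun a v v' => ?_
    simp only [(D.Riem_linear₁ hp w u).map_smul_add a v v', D.g_lin,
      (D.Ric_linear_left hp u).map_smul_add a v v', map_add, map_smul, smul_eq_mul]
    ring
  · refine isLinearMap_of_smul_add fun a w w' => ?_
    simp only [(D.Riem_linear₂ hp v u).map_smul_add a w w', D.g_lin,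
      (D.Ric_linear_left hp u).map_smul_add a w w', map_add, map_smul, smul_eq_mul]
    ring
  · refine isLinearMap_of_smul_add fun a u u' => ?_
    simp only [(D.Riem_linear₃ hp v w).map_smul_add a u u',
      fun x => (D.g_linear_right p x).map_smul_add a u u',
      fun x => (D.Ric_linear_right hp x).map_smul_add a u u', map_add, map_smul, smul_eq_mul]
    ring
  · have key := curvature_identity_three
      (R := fun i j k l => D.g p (D.Riem p (b i) (b j) (b k)) (b l))
      (fun l => fderiv ℝ f p (b l))
      (fun i j k l => by rw [D.Riem_swap, D.g_neg_left])
      (fun i j k l => by linarith [D.g_Riem_skew hp (b i) (b j) (b k) (b l)])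
      (fun i j => by simpa only [hRic] using Ric_symm_of_soliton hsol hp (b i) (b j)) i j k
    rw [hds, hds, hscal, hdf (D.Riem p (b i) (b j) (b k))]
    simp only [hRic, hb]
    linear_combination key

lemma covDeriv2_schouten_exp (hf : ContDiffOn ℝ (⊤ : ℕ∞) f D.U) (hp : p ∈ D.U) (v w u : E 3) :
    D.covDeriv2
        (fun p v w => (D.Ric p v w - D.scalar p / 2 * D.g p v w) * Real.exp (-f p)) p v w u
      = Real.exp (-f p) * (D.covDeriv2 D.Ric p v w u - fderiv ℝ D.scalar p v / 2 * D.g p w u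
        - fderiv ℝ f p v * (D.Ric p w u - D.scalar p / 2 * D.g p w u)) := by
  have hR := differentiableAt_of_contDiffOn D.hU (D.Ric_contDiffOn w u) hp
  have hs := (differentiableAt_of_contDiffOn D.hU D.scalar_contDiffOn hp).hasFDerivAt.mul_const
    (2⁻¹ : ℝ)
  have hg := D.g_differentiableAt hp w u
  have hf' := differentiableAt_of_contDiffOn D.hU hf hp
  have h := ((hR.hasFDerivAt.sub (hs.mul hg.hasFDerivAt)).mul hf'.hasFDerivAt.neg.exp).fderiv
  have h' := congrArg (fun L : E 3 →L[ℝ] ℝ => L v) h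
  simp only [covDeriv2, div_eq_mul_inv]
  refine (congrArg (fun x => x - _ - _) h').trans ?_
  simp [D.compat p hp]
  ring

end ThreeDimensional

end RiemannChart

/-- On every three-dimensional gradient Ricci soliton
(`Ric + ∇²f = λ g`), the tensor `T = (Ric - (R/2) g) e^{-f}` is a Codazzi tensor. -/
theorem soliton_schouten_exp_is_codazzi
    (D : RiemannChart 3) (f : E 3 → ℝ) (lam : ℝ)
    (hsol : D.IsGradientSoliton f lam) :
    D.IsCodazzi
      (fun p v w => (D.Ric p v w - D.scalar p / 2 * D.g p v w) * Real.exp (-f p)) := by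
  refine ⟨fun p hp v w => ?_, fun p hp a u v w => ?_, fun v w => ?_, fun p hp v w u => ?_⟩
  · beta_reduce
    rw [RiemannChart.Ric_symm_of_soliton hsol hp, D.g_symm]
  · beta_reduce
    rw [(D.Ric_linear_left hp w).map_smul_add, D.g_lin, smul_eq_mul]
    ring
  · exact ((D.Ric_contDiffOn v w).sub ((D.scalar_contDiffOn.div_const 2).mul
      (D.g_smooth v w))).mul hsol.1.neg.exp
  · rw [RiemannChart.covDeriv2_schouten_exp hsol.1 hp, RiemannChart.covDeriv2_schouten_exp hsol.1 hp]
    linear_combination Real.exp (-f p) * (RiemannChart.covDeriv2_Ric_sub hsol hp v w u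
      + RiemannChart.fderiv_Riem_eq_of_soliton hsol hp v w u)

end
end

section
/- Let (M³, g) be a three-dimensional gradient Ricci soliton (Ric + ∇²f = λ g) with strictly positive sectional curvature, on which the Ricci tensor has exactly two distinct eigenvalues, so that the Codazzi tensor T = (Ric − (R/2) g) e^{−f} has two distinct eigenvalues σ (multiplicity 2) and ρ (multiplicity 1). Let L be a connected component of an integral leaf of the two-dimensional eigendistribution V_σ on which both eigenvalues of T are constant. Then the potential function f is constant on L, and consequently the scalar curvature R and all eigenvalues of the Ricci tensor are constant on L. -/
noncomputable section

open scoped RealInnerProductSpace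

open Filter Topology

section DerivativeOfApplication

variable {X F H : Type*} [NormedAddCommGroup X] [NormedSpace ℝ X] [NormedAddCommGroup F]
  [NormedSpace ℝ F] [NormedAddCommGroup H] [NormedSpace ℝ H] {c : X → F →L[ℝ] H} {p : X}

lemma fderiv_clm_apply_apply {u : X → F} (hc : DifferentiableAt ℝ c p)
    (hu : DifferentiableAt ℝ u p) (m : X) :
    fderiv ℝ (fun q => c q (u q)) p m = fderiv ℝ c p m (u p) + c p (fderiv ℝ u p m) := by
  rw [fderiv_clm_apply hc hu]
  simp [add_comm]

lemma fderiv_clm_apply_const (hc : DifferentiableAt ℝ c p) (u : F) (m : X) :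
    fderiv ℝ (fun q => c q u) p m = fderiv ℝ c p m u := by
  rw [fderiv_clm_apply_apply hc (differentiableAt_const u)]
  simp

lemma fderiv_clm_apply_const₂ {K : Type*} [NormedAddCommGroup K] [NormedSpace ℝ K]
    {c : X → F →L[ℝ] H →L[ℝ] K} (hc : DifferentiableAt ℝ c p) (u : F) (v : H) (m : X) :
    fderiv ℝ (fun q => c q u v) p m = fderiv ℝ c p m u v := by
  rw [fderiv_clm_apply_const (hc.clm_apply (differentiableAt_const u)),
    fderiv_clm_apply_const hc]

lemma fderiv_clm_apply_apply₂ {K : Type*} [NormedAddCommGroup K] [NormedSpace ℝ K]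
    {c : X → F →L[ℝ] H →L[ℝ] K} {u : X → F} {v : X → H} (hc : DifferentiableAt ℝ c p)
    (hu : DifferentiableAt ℝ u p) (hv : DifferentiableAt ℝ v p) (m : X) :
    fderiv ℝ (fun q => c q (u q) (v q)) p m
      = fderiv ℝ c p m (u p) (v p) + c p (fderiv ℝ u p m) (v p)
        + c p (u p) (fderiv ℝ v p m) := by
  rw [fderiv_clm_apply_apply (hc.clm_apply hu) hv, fderiv_clm_apply_apply hc hu]
  simp

end DerivativeOfApplication

lemma ContDiffAt.differentiableAt_fderiv {X H : Type*} [NormedAddCommGroup X] [NormedSpace ℝ X]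
    [NormedAddCommGroup H] [NormedSpace ℝ H] {c : X → H} {p : X}
    (hc : ContDiffAt ℝ (⊤ : ℕ∞) c p) : DifferentiableAt ℝ (fderiv ℝ c) p :=
  (hc.fderiv_right (m := (⊤ : ℕ∞)) (by simp)).differentiableAt (by simp)

lemma ContDiffAt.fderiv_fderiv_symm {X H : Type*} [NormedAddCommGroup X] [NormedSpace ℝ X]
    [NormedAddCommGroup H] [NormedSpace ℝ H] {c : X → H} {p : X}
    (hc : ContDiffAt ℝ (⊤ : ℕ∞) c p) (u v : X) :
    fderiv ℝ (fderiv ℝ c) p u v = fderiv ℝ (fderiv ℝ c) p v u :=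
  hc.isSymmSndFDerivAt (by simp; exact WithTop.coe_le_coe.2 le_top) u v

/-- A smooth metric on an open subset of a normed space with its Levi-Civita connection,
both given as fields of continuous bilinear maps. -/
structure LeviCivitaField (F : Type*) [NormedAddCommGroup F] [NormedSpace ℝ F] where
  U : Set F
  isOpen : IsOpen U
  G : F → F →L[ℝ] F →L[ℝ] ℝ
  A : F → F →L[ℝ] F →L[ℝ] F
  G_symm : ∀ q v w, G q v w = G q w v
  A_symm : ∀ q v w, A q v w = A q w v
  contDiffAt_G : ∀ q ∈ U, ContDiffAt ℝ (⊤ : ℕ∞) G q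
  contDiffAt_A : ∀ q ∈ U, ContDiffAt ℝ (⊤ : ℕ∞) A q
  compat : ∀ q ∈ U, ∀ m v w, fderiv ℝ G q m v w = G q (A q m v) w + G q v (A q m w)

namespace LeviCivitaField

variable {F : Type*} [NormedAddCommGroup F] [NormedSpace ℝ F] (C : LeviCivitaField F)

/-- The curvature `R(v, w) z`. -/
def curv (q v w z : F) : F :=
  fderiv ℝ C.A q v w z - fderiv ℝ C.A q w v z + C.A q v (C.A q w z) - C.A q w (C.A q v z)

/-- The covariant derivative `(∇_m R)(i, j) k` of the curvature. -/
def nablaCurv (p m i j k : F) : F :=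
  fderiv ℝ (fun q => C.curv q i j k) p m + C.A p m (C.curv p i j k)
    - C.curv p (C.A p m i) j k - C.curv p i (C.A p m j) k - C.curv p i j (C.A p m k)

lemma curv_antisymm (q v w z : F) : C.curv q v w z = -C.curv q w v z := by
  simp only [curv]
  abel

lemma curv_self (q v z : F) : C.curv q v v z = 0 := by
  simp [curv]

lemma curv_add_left (q v v' w z : F) :
    C.curv q (v + v') w z = C.curv q v w z + C.curv q v' w z := by
  simp only [curv, map_add, add_apply]
  abel

lemma curv_smul_left (q : F) (c : ℝ) (v w z : F) :
    C.curv q (c • v) w z = c • C.curv q v w z := by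
  simp only [curv, map_smul, smul_apply, smul_add, smul_sub]

lemma curv_add_mid (q v w w' z : F) :
    C.curv q v (w + w') z = C.curv q v w z + C.curv q v w' z := by
  simp only [curv, map_add, add_apply]
  abel

lemma curv_smul_mid (q v : F) (c : ℝ) (w z : F) :
    C.curv q v (c • w) z = c • C.curv q v w z := by
  simp only [curv, map_smul, smul_apply, smul_add, smul_sub]

lemma curv_add_right (q v w z z' : F) :
    C.curv q v w (z + z') = C.curv q v w z + C.curv q v w z' := by
  simp only [curv, map_add]
  abel

lemma curv_smul_right (q v w : F) (c : ℝ) (z : F) :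
    C.curv q v w (c • z) = c • C.curv q v w z := by
  simp only [curv, map_smul, smul_add, smul_sub]

lemma curv_sum_left {ι : Type*} [Fintype ι] (q : F) (c : ι → ℝ) (v : ι → F) (w z : F) :
    C.curv q (∑ i, c i • v i) w z = ∑ i, c i • C.curv q (v i) w z := by
  let l : F →ₗ[ℝ] F :=
    { toFun := fun v => C.curv q v w z
      map_add' := fun v v' => C.curv_add_left q v v' w z
      map_smul' := fun c v => C.curv_smul_left q c v w z }
  have h := map_sum l (fun i => c i • v i) Finset.univ
  simp only [map_smul] at h
  exact h

variable {C} {p : F}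

lemma differentiableAt_curv (hp : p ∈ C.U) (v w z : F) :
    DifferentiableAt ℝ (fun q => C.curv q v w z) p := by
  have h0 := (C.contDiffAt_A p hp).differentiableAt (by simp)
  have h1 := (C.contDiffAt_A p hp).differentiableAt_fderiv
  simp only [curv]
  fun_prop

lemma fderiv_curv (hp : p ∈ C.U) (m v w z : F) :
    fderiv ℝ (fun q => C.curv q v w z) p m
      = fderiv ℝ (fderiv ℝ C.A) p m v w z - fderiv ℝ (fderiv ℝ C.A) p m w v z
        + (fderiv ℝ C.A p m v (C.A p w z) + C.A p v (fderiv ℝ C.A p m w z))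
        - (fderiv ℝ C.A p m w (C.A p v z) + C.A p w (fderiv ℝ C.A p m v z)) := by
  have h0 := (C.contDiffAt_A p hp).differentiableAt (by simp)
  have h1 := (C.contDiffAt_A p hp).differentiableAt_fderiv
  have h2 : ∀ v w, DifferentiableAt ℝ (fun q => fderiv ℝ C.A q v w z) p := fun v w => by
    fun_prop
  have h3 : ∀ v w, DifferentiableAt ℝ (fun q => C.A q v (C.A q w z)) p := fun v w => by
    fun_prop
  have e2 : ∀ v w, fderiv ℝ (fun q => fderiv ℝ C.A q v w z) p m
      = fderiv ℝ (fderiv ℝ C.A) p m v w z := fun v w => by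
    rw [fderiv_clm_apply_const (by fun_prop), fderiv_clm_apply_const₂ h1]
  have e3 : ∀ v w, fderiv ℝ (fun q => C.A q v (C.A q w z)) p m
      = fderiv ℝ C.A p m v (C.A p w z) + C.A p v (fderiv ℝ C.A p m w z) := fun v w => by
    rw [fderiv_clm_apply_apply (c := fun q => C.A q v) (by fun_prop) (by fun_prop),
      fderiv_clm_apply_const h0, fderiv_clm_apply_const₂ h0]
  simp only [curv]
  rw [fderiv_fun_sub (((h2 v w).fun_sub (h2 w v)).fun_add (h3 v w)) (h3 w v),
    fderiv_fun_add ((h2 v w).fun_sub (h2 w v)) (h3 v w), fderiv_fun_sub (h2 v w) (h2 w v)]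
  simp only [sub_apply, add_apply, e2, e3]

/-- The second Bianchi identity. -/
lemma nablaCurv_cyclic (hp : p ∈ C.U) (m i j k : F) :
    C.nablaCurv p m i j k + C.nablaCurv p i j m k + C.nablaCurv p j m i k = 0 := by
  have hs := (C.contDiffAt_A p hp).fderiv_fderiv_symm
  simp only [nablaCurv, fderiv_curv hp, C.curv_antisymm p j (C.A p i m),
    C.A_symm p j i, C.A_symm p m j, C.A_symm p m i, hs i m, hs j m, hs j i]
  simp only [curv, map_add, map_sub]
  abel

lemma nablaCurv_antisymm (hp : p ∈ C.U) (m i j k : F) :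
    C.nablaCurv p m i j k = -C.nablaCurv p m j i k := by
  simp only [nablaCurv, fderiv_curv hp]
  simp only [curv, map_add, map_sub]
  abel

/-- The curvature operator is skew with respect to the metric. -/
lemma G_curv_skew (hp : p ∈ C.U) (i j k l : F) :
    C.G p (C.curv p i j k) l + C.G p k (C.curv p i j l) = 0 := by
  have h0 := (C.contDiffAt_A p hp).differentiableAt (by simp)
  have hg := (C.contDiffAt_G p hp).differentiableAt (by simp)
  have hs : ContDiffAt ℝ (⊤ : ℕ∞) (fun q => C.G q k l) p :=
    ((C.contDiffAt_G p hp).clm_apply contDiffAt_const).clm_apply contDiffAt_const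
  have key : ∀ m v, fderiv ℝ (fderiv ℝ fun q => C.G q k l) p m v
      = fderiv ℝ C.G p m (C.A p v k) l + C.G p (fderiv ℝ C.A p m v k) l
        + (fderiv ℝ C.G p m k (C.A p v l) + C.G p k (fderiv ℝ C.A p m v l)) := by
    intro m v
    have he : (fun q => fderiv ℝ (fun q => C.G q k l) q v) =ᶠ[𝓝 p]
        fun q => C.G q (C.A q v k) l + C.G q k (C.A q v l) := by
      filter_upwards [C.isOpen.mem_nhds hp] with q hq
      rw [fderiv_clm_apply_const₂ ((C.contDiffAt_G q hq).differentiableAt (by simp)),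
        C.compat q hq]
    have hA : ∀ w, DifferentiableAt ℝ (fun q => C.A q v w) p := fun w => by fun_prop
    rw [← fderiv_clm_apply_const hs.differentiableAt_fderiv, he.fderiv_eq,
      fderiv_fun_add ((hg.clm_apply (hA k)).clm_apply (differentiableAt_const l))
        ((hg.clm_apply (differentiableAt_const k)).clm_apply (hA l)), add_apply,
      fderiv_clm_apply_apply₂ hg (hA k) (differentiableAt_const l),
      fderiv_clm_apply_apply₂ hg (differentiableAt_const k) (hA l),
      fderiv_clm_apply_const₂ h0, fderiv_clm_apply_const₂ h0]
    simp
  have h := hs.fderiv_fderiv_symm i j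
  rw [key, key] at h
  simp only [C.compat p hp] at h
  simp only [curv, map_add, map_sub, add_apply, sub_apply]
  linarith

lemma G_nablaCurv_skew (hp : p ∈ C.U) (m i j k l : F) :
    C.G p (C.nablaCurv p m i j k) l + C.G p k (C.nablaCurv p m i j l) = 0 := by
  have hK := differentiableAt_curv hp i j
  have hg := (C.contDiffAt_G p hp).differentiableAt (by simp)
  have he : (fun q => C.G q (C.curv q i j k) l + C.G q k (C.curv q i j l))
      =ᶠ[𝓝 p] fun _ => 0 := by
    filter_upwards [C.isOpen.mem_nhds hp] with q hq using G_curv_skew hq i j k l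
  have h : fderiv ℝ (fun q => C.G q (C.curv q i j k) l + C.G q k (C.curv q i j l)) p m = 0 := by
    rw [he.fderiv_eq]
    simp
  rw [fderiv_fun_add ((hg.clm_apply (hK k)).clm_apply (differentiableAt_const l))
      ((hg.clm_apply (differentiableAt_const k)).clm_apply (hK l)),
    add_apply,
    fderiv_clm_apply_apply₂ hg (hK k) (differentiableAt_const l),
    fderiv_clm_apply_apply₂ hg (differentiableAt_const k) (hK l)] at h
  simp only [C.compat p hp, fderiv_fun_const,
    Pi.zero_apply, zero_apply, map_zero, add_zero] at h
  have e1 := G_curv_skew hp (C.A p m i) j k l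
  have e2 := G_curv_skew hp i (C.A p m j) k l
  have e3 := G_curv_skew hp i j (C.A p m k) l
  have e4 := G_curv_skew hp i j k (C.A p m l)
  simp only [nablaCurv, map_add, map_sub, add_apply,
    sub_apply]
  linarith

section Frame

variable {ι : Type*} [Fintype ι] {b : ι → F}

variable (C) in
/-- The Ricci tensor, as a trace taken in a `C.G p`-orthonormal frame `b`. -/
def ricci (p : F) (b : ι → F) (q v w : F) : ℝ := ∑ a, C.G p (C.curv q (b a) v w) (b a)

variable (C) in
/-- The covariant derivative `(∇_m Ric)(v, w)` at `p`. -/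
def nablaRicci (p : F) (b : ι → F) (m v w : F) : ℝ :=
  fderiv ℝ (fun q => C.ricci p b q v w) p m - C.ricci p b p (C.A p m v) w
    - C.ricci p b p v (C.A p m w)

lemma fderiv_ricci (hp : p ∈ C.U) (m v w : F) :
    fderiv ℝ (fun q => C.ricci p b q v w) p m
      = ∑ a, C.G p (fderiv ℝ (fun q => C.curv q (b a) v w) p m) (b a) := by
  have hK := fun a => differentiableAt_curv hp (b a) v w
  simp only [ricci]
  rw [fderiv_fun_sum (fun a _ => by have := hK a; fun_prop), sum_apply]
  refine Finset.sum_congr rfl fun a _ => ?_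
  rw [fderiv_clm_apply_apply₂ (differentiableAt_const _) (hK a) (differentiableAt_const _)]
  simp

lemma differentiableAt_ricci (hp : p ∈ C.U) (v w : F) :
    DifferentiableAt ℝ (fun q => C.ricci p b q v w) p := by
  have hK := fun a => differentiableAt_curv hp (b a) v w
  simp only [ricci]
  fun_prop

/-- Covariant differentiation commutes with the trace defining the Ricci tensor. -/
lemma nablaRicci_eq (hp : p ∈ C.U) (hb : ∀ x, x = ∑ c, C.G p x (b c) • b c) (m v w : F) :
    C.nablaRicci p b m v w = ∑ a, C.G p (C.nablaCurv p m (b a) v w) (b a) := by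
  have h1 : ∑ a, C.G p (C.A p m (C.curv p (b a) v w)) (b a)
      = ∑ a, ∑ c, C.G p (C.curv p (b a) v w) (b c) * C.G p (C.A p m (b c)) (b a) := by
    refine Finset.sum_congr rfl fun a _ => ?_
    conv_lhs => rw [hb (C.curv p (b a) v w)]
    simp only [map_sum, map_smul, sum_apply, smul_apply, smul_eq_mul]
  have h2 : ∑ a, C.G p (C.curv p (C.A p m (b a)) v w) (b a)
      = ∑ a, ∑ c, C.G p (C.A p m (b a)) (b c) * C.G p (C.curv p (b c) v w) (b a) := by
    refine Finset.sum_congr rfl fun a _ => ?_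
    conv_lhs => rw [hb (C.A p m (b a)), curv_sum_left]
    simp only [map_sum, map_smul, sum_apply, smul_apply, smul_eq_mul]
  have h3 : ∑ a, C.G p (C.A p m (C.curv p (b a) v w)) (b a)
      = ∑ a, C.G p (C.curv p (C.A p m (b a)) v w) (b a) := by
    rw [h1, h2, Finset.sum_comm]
    exact Finset.sum_congr rfl fun a _ => Finset.sum_congr rfl fun c _ => mul_comm _ _
  simp only [nablaRicci, fderiv_ricci hp, nablaCurv, map_add, map_sub, add_apply, sub_apply,
    Finset.sum_add_distrib, Finset.sum_sub_distrib, h3]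
  simp only [ricci]
  ring

/-- The contracted second Bianchi identity. -/
lemma sum_nablaRicci (hp : p ∈ C.U) (hb : ∀ x, x = ∑ c, C.G p x (b c) • b c) (m : F) :
    ∑ a, C.nablaRicci p b m (b a) (b a) = 2 * ∑ a, C.nablaRicci p b (b a) m (b a) := by
  simp only [nablaRicci_eq hp hb]
  have h1 : ∀ a c, C.G p (C.nablaCurv p m (b c) (b a) (b a)) (b c)
      = C.G p (C.nablaCurv p (b a) (b c) m (b a)) (b c)
        + C.G p (C.nablaCurv p (b c) (b a) m (b c)) (b a) := fun a c => by
    have e1 := congrArg (fun x => C.G p x (b c)) (nablaCurv_cyclic hp m (b c) (b a) (b a))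
    have e2 := G_nablaCurv_skew hp (b c) (b a) m (b a) (b c)
    rw [nablaCurv_antisymm hp (b a) m] at e1
    simp only [map_add, map_neg, add_apply, neg_apply, map_zero, zero_apply] at e1
    rw [C.G_symm p (b a)] at e2
    linarith
  simp only [h1, Finset.sum_add_distrib]
  rw [Finset.sum_comm (f := fun a c => C.G p (C.nablaCurv p (b c) (b a) m (b c)) (b a))]
  ring

/-- The tensor `Ric` of a soliton fails to be Codazzi by a curvature term. -/
lemma nablaRicci_sub_nablaRicci (hp : p ∈ C.U) {f : F → ℝ} {lam : ℝ}
    (hf : ContDiffAt ℝ (⊤ : ℕ∞) f p)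
    (hsol : ∀ q ∈ C.U, ∀ v w, C.ricci p b q v w
      + (fderiv ℝ (fun q => fderiv ℝ f q w) q v - fderiv ℝ f q (C.A q v w)) = lam * C.G q v w)
    (m j k : F) :
    C.nablaRicci p b m j k - C.nablaRicci p b j m k = fderiv ℝ f p (C.curv p m j k) := by
  have h0 := (C.contDiffAt_A p hp).differentiableAt (by simp)
  have hg := (C.contDiffAt_G p hp).differentiableAt (by simp)
  have h1 := hf.differentiableAt_fderiv
  have hfk : ContDiffAt ℝ (⊤ : ℕ∞) (fun q => fderiv ℝ f q k) p :=
    (hf.fderiv_right (m := (⊤ : ℕ∞)) (by simp)).clm_apply contDiffAt_const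
  have h2 := hfk.differentiableAt_fderiv
  have key : ∀ m j, fderiv ℝ (fun q => C.ricci p b q j k) p m
      = lam * (C.G p (C.A p m j) k + C.G p j (C.A p m k))
        - (fderiv ℝ (fderiv ℝ fun q => fderiv ℝ f q k) p m j
          - (fderiv ℝ (fderiv ℝ f) p m (C.A p j k)
            + fderiv ℝ f p (fderiv ℝ C.A p m j k))) := by
    intro m j
    have he : (fun q => C.ricci p b q j k) =ᶠ[𝓝 p] fun q => lam * C.G q j k
        - (fderiv ℝ (fun q => fderiv ℝ f q k) q j - fderiv ℝ f q (C.A q j k)) := by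
      filter_upwards [C.isOpen.mem_nhds hp] with q hq
      linarith [hsol q hq j k]
    have d1 : DifferentiableAt ℝ (fun q => C.G q j k) p := by fun_prop
    have d2 : DifferentiableAt ℝ (fun q => fderiv ℝ (fun q => fderiv ℝ f q k) q j) p := by
      fun_prop
    have d3 : DifferentiableAt ℝ (fun q => C.A q j k) p := by fun_prop
    have d4 := h1.clm_apply d3
    rw [he.fderiv_eq, fderiv_fun_sub (d1.const_mul lam) (d2.fun_sub d4),
      fderiv_fun_sub d2 d4, fderiv_const_mul d1]
    simp only [sub_apply, smul_apply, smul_eq_mul]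
    rw [fderiv_clm_apply_const₂ hg, C.compat p hp, fderiv_clm_apply_const h2,
      fderiv_clm_apply_apply h1 d3, fderiv_clm_apply_const₂ h0]
  have hric : ∀ v w, C.ricci p b p v w = lam * C.G p v w
      - (fderiv ℝ (fderiv ℝ f) p v w - fderiv ℝ f p (C.A p v w)) := fun v w => by
    rw [← fderiv_clm_apply_const h1]
    linarith [hsol p hp v w]
  simp only [nablaRicci, key, hric, curv, map_add, map_sub]
  rw [hfk.fderiv_fderiv_symm m j, C.A_symm p m j, hf.fderiv_fderiv_symm j (C.A p m k),
    hf.fderiv_fderiv_symm m (C.A p j k)]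
  ring

/-- On an eigenvector of the Ricci tensor, the identity `∇R = 2 Ric(∇f)` reads as follows. -/
lemma sum_nablaRicci_of_eigenvector (hp : p ∈ C.U)
    (hb : ∀ x, x = ∑ c, C.G p x (b c) • b c) {f : F → ℝ} {lam : ℝ}
    (hf : ContDiffAt ℝ (⊤ : ℕ∞) f p)
    (hsol : ∀ q ∈ C.U, ∀ v w, C.ricci p b q v w
      + (fderiv ℝ (fun q => fderiv ℝ f q w) q v - fderiv ℝ f q (C.A q v w)) = lam * C.G q v w)
    {m : F} {s : ℝ} (hm : ∀ l, C.ricci p b p m l = s * C.G p m l) :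
    ∑ a, C.nablaRicci p b m (b a) (b a) = 2 * (s * fderiv ℝ f p m) := by
  have h1 : ∑ a, C.curv p m (b a) (b a) = s • m := by
    rw [hb (∑ a, C.curv p m (b a) (b a)), hb (s • m)]
    refine Finset.sum_congr rfl fun c _ => ?_
    congr 1
    rw [map_smul, smul_apply, smul_eq_mul, ← hm, ricci, map_sum, sum_apply]
    refine Finset.sum_congr rfl fun a _ => ?_
    have h := G_curv_skew hp m (b a) (b a) (b c)
    rw [C.curv_antisymm p m (b a) (b c), map_neg, C.G_symm p (b a)] at h
    linarith
  have h2 := sum_nablaRicci hp hb m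
  have h3 : ∑ a, C.nablaRicci p b m (b a) (b a) - ∑ a, C.nablaRicci p b (b a) m (b a)
      = s * fderiv ℝ f p m := by
    rw [← Finset.sum_sub_distrib]
    simp only [nablaRicci_sub_nablaRicci hp hf hsol]
    rw [← map_sum, h1, map_smul, smul_eq_mul]
  linarith

end Frame

section Trace

variable {κ : Type*} [Fintype κ] [DecidableEq κ]

lemma differentiableAt_det {M : F → Matrix κ κ ℝ}
    (hM : ∀ i j, DifferentiableAt ℝ (fun q => M q i j) p) :
    DifferentiableAt ℝ (fun q => (M q).det) p := by
  simp only [Matrix.det_apply']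
  have h : ∀ s : Equiv.Perm κ, DifferentiableAt ℝ (fun q => ∏ i, M q (s i) i) p := fun s =>
    (HasFDerivAt.finsetProd fun i _ => (hM (s i) i).hasFDerivAt).differentiableAt
  fun_prop

lemma differentiableAt_of_mul_eq_one {H M : F → Matrix κ κ ℝ}
    (hM : ∀ i j, DifferentiableAt ℝ (fun q => M q i j) p) (hHM : ∀ᶠ q in 𝓝 p, H q * M q = 1)
    (i j : κ) : DifferentiableAt ℝ (fun q => H q i j) p := by
  have hne : (M p).det ≠ 0 := fun h => by
    have := congrArg Matrix.det hHM.self_of_nhds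
    simp [h] at this
  have he : (fun q => H q i j) =ᶠ[𝓝 p]
      fun q => (M q).det⁻¹ * ((M q).updateRow j (Pi.single i 1)).det := by
    filter_upwards [hHM] with q hq
    rw [← Matrix.inv_eq_left_inv hq, Matrix.inv_def, Matrix.smul_apply, smul_eq_mul,
      Matrix.adjugate_apply, Ring.inverse_eq_inv]
  refine DifferentiableAt.congr_of_eventuallyEq ?_ he
  refine ((differentiableAt_det hM).inv hne).mul (differentiableAt_det fun k l => ?_)
  by_cases hk : k = j
  · subst hk
    simp
  · simpa [Matrix.updateRow_ne hk] using hM k l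

variable {ι : Type*} [Fintype ι] {b : ι → F} (e : Module.Basis κ ℝ F) {H : F → κ → κ → ℝ}

lemma sum_inverse_metric (hH : ∀ i j, ∑ k, H p i k * C.G p (e k) (e j) = if i = j then 1 else 0)
    (i : κ) (x : F) : ∑ k, H p i k * C.G p (e k) x = e.repr x i := by
  have h : ∑ k, H p i k • (C.G p (e k) : F →ₗ[ℝ] ℝ) = e.coord i := e.ext fun j => by
    simpa [Finsupp.single_apply, eq_comm] using hH i j
  simpa using DFunLike.congr_fun h x

/-- The trace of a bilinear form in an orthonormal frame and in a general basis. -/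
lemma sum_frame_eq (hH : ∀ i j, ∑ k, H p i k * C.G p (e k) (e j) = if i = j then 1 else 0)
    (hb : ∀ x, x = ∑ c, C.G p x (b c) • b c) (B : F →ₗ[ℝ] F →ₗ[ℝ] ℝ) :
    ∑ i, ∑ j, H p i j * B (e i) (e j) = ∑ a, B (b a) (b a) := by
  have h1 : ∀ a, B (b a) (b a) = ∑ i, ∑ j, H p i j * (C.G p (e j) (b a) * B (e i) (b a)) := by
    intro a
    have h : B (b a) (b a) = ∑ i, e.repr (b a) i * B (e i) (b a) := by
      conv_lhs => enter [1]; rw [← e.sum_repr (b a)]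
      simp only [map_sum, map_smul, LinearMap.sum_apply, LinearMap.smul_apply, smul_eq_mul]
    simp only [h, ← sum_inverse_metric e hH, Finset.sum_mul, mul_assoc]
  have h2 : ∀ i j, B (e i) (e j) = ∑ a, C.G p (e j) (b a) * B (e i) (b a) := by
    intro i j
    conv_lhs => rw [hb (e j)]
    simp
  simp only [h1, h2, Finset.mul_sum]
  rw [Finset.sum_comm]
  simp_rw [Finset.sum_comm (s := (Finset.univ : Finset ι))]
  rw [Finset.sum_comm]

lemma differentiableAt_inverse_metric (hp : p ∈ C.U)
    (hH : ∀ q ∈ C.U, ∀ i j, ∑ k, H q i k * C.G q (e k) (e j) = if i = j then 1 else 0)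
    (i j : κ) : DifferentiableAt ℝ (fun q => H q i j) p := by
  have hg := (C.contDiffAt_G p hp).differentiableAt (by simp)
  refine differentiableAt_of_mul_eq_one (H := fun q => Matrix.of (H q))
    (M := fun q => Matrix.of fun i j => C.G q (e i) (e j)) (fun i j => ?_) ?_ i j
  · simp only [Matrix.of_apply]
    fun_prop
  · filter_upwards [C.isOpen.mem_nhds hp] with q hq
    ext i j
    simpa [Matrix.mul_apply, Matrix.one_apply] using hH q hq i j

/-- The derivative of a metric trace is the trace of the covariant derivative. -/
lemma fderiv_sum_inverse_metric (hp : p ∈ C.U)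
    (hH : ∀ q ∈ C.U, ∀ i j, ∑ k, H q i k * C.G q (e k) (e j) = if i = j then 1 else 0)
    (hb : ∀ x, x = ∑ c, C.G p x (b c) • b c) {S : F → F →ₗ[ℝ] F →ₗ[ℝ] ℝ}
    (hS : ∀ v w, DifferentiableAt ℝ (fun q => S q v w) p) (m : F) :
    fderiv ℝ (fun q => ∑ i, ∑ j, H q i j * S q (e i) (e j)) p m
      = ∑ i, ∑ j, H p i j * (fderiv ℝ (fun q => S q (e i) (e j)) p m
        - S p (C.A p m (e i)) (e j) - S p (e i) (C.A p m (e j))) := by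
  have hg := (C.contDiffAt_G p hp).differentiableAt (by simp)
  have hM : ∀ i j, DifferentiableAt ℝ (fun q => C.G q (e i) (e j)) p := fun i j => by fun_prop
  have hHd := differentiableAt_inverse_metric e hp hH
  have hdH : ∀ i x, ∑ k, fderiv ℝ (fun q => H q i k) p m * C.G p (e k) x
      = -∑ k, H p i k * (C.G p (C.A p m (e k)) x + C.G p (e k) (C.A p m x)) := by
    intro i
    have hbase : ∀ j, ∑ k, fderiv ℝ (fun q => H q i k) p m * C.G p (e k) (e j)
      = -∑ k, H p i k * (C.G p (C.A p m (e k)) (e j) + C.G p (e k) (C.A p m (e j))) := by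
      intro j
      have he : (fun q => ∑ k, H q i k * C.G q (e k) (e j))
          =ᶠ[𝓝 p] fun _ => if i = j then 1 else 0 := by
        filter_upwards [C.isOpen.mem_nhds hp] with q hq using hH q hq i j
      have h : fderiv ℝ (fun q => ∑ k, H q i k * C.G q (e k) (e j)) p m = 0 := by
        rw [he.fderiv_eq]
        simp
      rw [fderiv_fun_sum (fun k _ => (hHd i k).fun_mul (hM k j)), sum_apply] at h
      simp_rw [fderiv_fun_mul (hHd i _) (hM _ j)] at h
      simp only [add_apply, smul_apply, smul_eq_mul, fderiv_clm_apply_const₂ hg, C.compat p hp,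
        Finset.sum_add_distrib] at h
      simp only [mul_comm (fderiv ℝ _ p m)]
      linarith
    have h : ∑ k, fderiv ℝ (fun q => H q i k) p m • (C.G p (e k) : F →ₗ[ℝ] ℝ)
        = -∑ k, H p i k • ((C.G p (C.A p m (e k)) : F →ₗ[ℝ] ℝ)
          + (C.G p (e k) : F →ₗ[ℝ] ℝ) ∘ₗ (C.A p m : F →ₗ[ℝ] F)) := e.ext fun j => by
      simpa [mul_add] using hbase j
    intro x
    simpa [mul_add] using DFunLike.congr_fun h x
  let sharp : F →ₗ[ℝ] F := ∑ a, ((S p).flip (b a)).smulRight (b a)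
  have hsharp : ∀ x y, S p x y = C.G p y (sharp x) := by
    intro x y
    conv_lhs => rw [hb y]
    simp [sharp, mul_comm]
  have htr : ∀ l : F →ₗ[ℝ] F,
      ∑ i, ∑ k, H p i k * C.G p (e k) (l (e i)) = LinearMap.trace ℝ F l := by
    intro l
    rw [LinearMap.trace_eq_matrix_trace ℝ e, Matrix.trace]
    refine Finset.sum_congr rfl fun i _ => ?_
    rw [sum_inverse_metric e (hH p hp), Matrix.diag_apply, LinearMap.toMatrix_apply]
  have hcomm := (htr ((C.A p m : F →ₗ[ℝ] F) * sharp)).trans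
    ((LinearMap.trace_mul_comm ℝ _ _).trans (htr (sharp * (C.A p m : F →ₗ[ℝ] F))).symm)
  simp only [Module.End.mul_apply, ContinuousLinearMap.coe_coe] at hcomm
  have hprod : ∀ i j, DifferentiableAt ℝ (fun q => H q i j * S q (e i) (e j)) p :=
    fun i j => (hHd i j).fun_mul (hS _ _)
  have hd : fderiv ℝ (fun q => ∑ i, ∑ j, H q i j * S q (e i) (e j)) p m
      = ∑ i, ∑ j, (H p i j * fderiv ℝ (fun q => S q (e i) (e j)) p m
        + S p (e i) (e j) * fderiv ℝ (fun q => H q i j) p m) := by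
    rw [fderiv_fun_sum (fun i _ => DifferentiableAt.fun_sum fun j _ => hprod i j), sum_apply]
    refine Finset.sum_congr rfl fun i _ => ?_
    rw [fderiv_fun_sum (fun j _ => hprod i j), sum_apply]
    refine Finset.sum_congr rfl fun j _ => ?_
    rw [fderiv_fun_mul (hHd i j) (hS _ _)]
    rfl
  rw [hd]
  have hkey : ∀ i, ∑ j, S p (e i) (e j) * fderiv ℝ (fun q => H q i j) p m
      = -∑ k, H p i k * S p (e i) (C.A p m (e k))
        - ∑ k, H p i k * C.G p (e k) (C.A p m (sharp (e i))) := by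
    intro i
    simp only [hsharp (e i), mul_comm (C.G p _ _) (fderiv ℝ _ p m), hdH, mul_add,
      Finset.sum_add_distrib]
    ring
  simp only [Finset.sum_add_distrib, hkey, mul_sub, Finset.sum_sub_distrib,
    Finset.sum_neg_distrib, hcomm, ← hsharp]
  ring

lemma ricci_add_left (q v v' w : F) :
    C.ricci p b q (v + v') w = C.ricci p b q v w + C.ricci p b q v' w := by
  simp only [ricci, curv_add_mid, map_add, add_apply, Finset.sum_add_distrib]

lemma ricci_smul_left (q : F) (c : ℝ) (v w : F) :
    C.ricci p b q (c • v) w = c * C.ricci p b q v w := by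
  simp only [ricci, curv_smul_mid, map_smul, smul_apply, smul_eq_mul, Finset.mul_sum]

lemma ricci_add_right (q v w w' : F) :
    C.ricci p b q v (w + w') = C.ricci p b q v w + C.ricci p b q v w' := by
  simp only [ricci, curv_add_right, map_add, add_apply, Finset.sum_add_distrib]

lemma ricci_smul_right (q : F) (c : ℝ) (v w : F) :
    C.ricci p b q v (c • w) = c * C.ricci p b q v w := by
  simp only [ricci, curv_smul_right, map_smul, smul_apply, smul_eq_mul, Finset.mul_sum]

variable (C p b) in
/-- The Ricci tensor as a bilinear form. -/
def ricciForm (q : F) : F →ₗ[ℝ] F →ₗ[ℝ] ℝ :=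
  LinearMap.mk₂ ℝ (C.ricci p b q) (C.ricci_add_left q) (C.ricci_smul_left q)
    (C.ricci_add_right q) (C.ricci_smul_right q)

/-- `∇_m Ric` as a bilinear form. -/
def nablaRicciForm (hp : p ∈ C.U) (b : ι → F) (m : F) : F →ₗ[ℝ] F →ₗ[ℝ] ℝ :=
  LinearMap.mk₂ ℝ (C.nablaRicci p b m)
    (fun v v' w => by
      simp only [nablaRicci, ricci_add_left, map_add]
      rw [fderiv_fun_add (differentiableAt_ricci hp v w) (differentiableAt_ricci hp v' w),
        add_apply]
      ring)
    (fun c v w => by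
      simp only [nablaRicci, ricci_smul_left, map_smul]
      rw [fderiv_const_mul (differentiableAt_ricci hp v w), smul_apply]
      simp only [smul_eq_mul]
      ring)
    (fun v w w' => by
      simp only [nablaRicci, ricci_add_right, map_add]
      rw [fderiv_fun_add (differentiableAt_ricci hp v w) (differentiableAt_ricci hp v w'),
        add_apply]
      ring)
    (fun c v w => by
      simp only [nablaRicci, ricci_smul_right, map_smul]
      rw [fderiv_const_mul (differentiableAt_ricci hp v w), smul_apply]
      simp only [smul_eq_mul]
      ring)

variable {R : F → ℝ}

lemma differentiableAt_scalar (hp : p ∈ C.U)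
    (hH : ∀ q ∈ C.U, ∀ i j, ∑ k, H q i k * C.G q (e k) (e j) = if i = j then 1 else 0)
    (hR : ∀ q ∈ C.U, R q = ∑ i, ∑ j, H q i j * C.ricci p b q (e i) (e j)) :
    DifferentiableAt ℝ R p :=
  (DifferentiableAt.fun_sum fun i _ => DifferentiableAt.fun_sum fun j _ =>
    (differentiableAt_inverse_metric e hp hH i j).fun_mul
      (differentiableAt_ricci hp (e i) (e j))).congr_of_eventuallyEq <| by
    filter_upwards [C.isOpen.mem_nhds hp] with q hq using hR q hq

lemma scalar_eq (hp : p ∈ C.U)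
    (hH : ∀ q ∈ C.U, ∀ i j, ∑ k, H q i k * C.G q (e k) (e j) = if i = j then 1 else 0)
    (hb : ∀ x, x = ∑ c, C.G p x (b c) • b c)
    (hR : ∀ q ∈ C.U, R q = ∑ i, ∑ j, H q i j * C.ricci p b q (e i) (e j)) :
    R p = ∑ a, C.ricci p b p (b a) (b a) :=
  (hR p hp).trans (sum_frame_eq e (hH p hp) hb (C.ricciForm p b p))

/-- The soliton identity `∇R = 2 Ric(∇f)` along an eigenvector of the Ricci tensor. -/
lemma fderiv_scalar_of_eigenvector (hp : p ∈ C.U)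
    (hH : ∀ q ∈ C.U, ∀ i j, ∑ k, H q i k * C.G q (e k) (e j) = if i = j then 1 else 0)
    (hb : ∀ x, x = ∑ c, C.G p x (b c) • b c)
    (hR : ∀ q ∈ C.U, R q = ∑ i, ∑ j, H q i j * C.ricci p b q (e i) (e j))
    {f : F → ℝ} {lam : ℝ} (hf : ContDiffAt ℝ (⊤ : ℕ∞) f p)
    (hsol : ∀ q ∈ C.U, ∀ v w, C.ricci p b q v w
      + (fderiv ℝ (fun q => fderiv ℝ f q w) q v - fderiv ℝ f q (C.A q v w)) = lam * C.G q v w)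
    {m : F} {s : ℝ} (hm : ∀ l, C.ricci p b p m l = s * C.G p m l) :
    fderiv ℝ R p m = 2 * (s * fderiv ℝ f p m) := by
  rw [← sum_nablaRicci_of_eigenvector hp hb hf hsol hm]
  have he : R =ᶠ[𝓝 p] fun q => ∑ i, ∑ j, H q i j * C.ricciForm p b q (e i) (e j) := by
    filter_upwards [C.isOpen.mem_nhds hp] with q hq using hR q hq
  rw [he.fderiv_eq, fderiv_sum_inverse_metric e hp hH hb
    (fun v w => differentiableAt_ricci hp v w)]
  exact sum_frame_eq e (hH p hp) hb (nablaRicciForm hp b m)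

end Trace

end LeviCivitaField

section Frame

variable {F : Type*} [AddCommGroup F] [Module ℝ F] {g : F →ₗ[ℝ] F →ₗ[ℝ] ℝ}

lemma exists_unit_smul {v : F} (hv : 0 < g v v) : ∃ c : ℝ, g (c • v) (c • v) = 1 :=
  ⟨(√(g v v))⁻¹, by
    have h : √(g v v) ≠ 0 := (Real.sqrt_pos.2 hv).ne'
    have h2 := Real.mul_self_sqrt hv.le
    simp only [map_smul, LinearMap.smul_apply, smul_eq_mul]
    field_simp
    linarith⟩

lemma exists_unit_mem {P : Submodule ℝ F} (hg : ∀ v, v ≠ 0 → 0 < g v v) (hP : P ≠ ⊥) :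
    ∃ v ∈ P, g v v = 1 := by
  obtain ⟨v, hv, h0⟩ := P.exists_mem_ne_zero_of_ne_bot hP
  obtain ⟨c, hc⟩ := exists_unit_smul (hg v h0)
  exact ⟨c • v, P.smul_mem c hv, hc⟩

lemma exists_orthonormal_pair {P : Submodule ℝ F} (hg : ∀ v, v ≠ 0 → 0 < g v v)
    (hP : Module.finrank ℝ P = 2) :
    ∃ u ∈ P, ∃ v ∈ P, g u u = 1 ∧ g v v = 1 ∧ g v u = 0 := by
  obtain ⟨u, hu, h1⟩ := exists_unit_mem hg (P := P) (by rintro rfl; simp at hP)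
  obtain ⟨v, hv, hvu⟩ : ∃ v ∈ P, v ∉ Submodule.span ℝ {u} := by
    by_contra! h
    have h2 := Submodule.finrank_mono (show P ≤ Submodule.span ℝ {u} from h)
    have h3 := finrank_span_le_card (R := ℝ) ({u} : Set F)
    simp only [Set.toFinset_singleton, Finset.card_singleton] at h3
    omega
  have hw : v - g v u • u ≠ 0 := fun h => hvu <| by
    rw [sub_eq_zero.1 h]
    exact Submodule.smul_mem _ _ (Submodule.mem_span_singleton_self u)
  obtain ⟨c, hc⟩ := exists_unit_smul (hg _ hw)
  exact ⟨u, hu, _, P.smul_mem c (P.sub_mem hv (P.smul_mem _ hu)), h1, hc, by simp [h1]⟩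

lemma eq_sum_of_orthonormal {ι : Type*} [Fintype ι] [Nonempty ι] [DecidableEq ι]
    {b : ι → F}
    (hcard : Fintype.card ι = Module.finrank ℝ F)
    (hb : ∀ i j, g (b i) (b j) = if i = j then 1 else 0) (x : F) :
    x = ∑ c, g x (b c) • b c := by
  have hli : LinearIndependent ℝ b := Fintype.linearIndependent_iff.2 fun c h i => by
    simpa [hb] using congrArg (fun y => g y (b i)) h
  let B := basisOfLinearIndependentOfCardEqFinrank hli hcard
  have hB : ∀ c, g x (b c) = B.repr x c := fun c => by
    conv_lhs => rw [← B.sum_repr x]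
    simp [B, hb]
  simpa [hB, B] using (B.sum_repr x).symm

/-- An orthonormal frame of a 3-space adapted to two eigenspaces of a symmetric form. -/
lemma exists_adapted_frame (hs : ∀ v w, g v w = g w v) (hg : ∀ v, v ≠ 0 → 0 < g v v)
    {r : F → F → ℝ} (hr : ∀ v w, r v w = r w v) {s t : ℝ}
    (hst : s ≠ t) {P Q : Submodule ℝ F} (hP : ∀ v ∈ P, ∀ w, r v w = s * g v w)
    (hQ : ∀ v ∈ Q, ∀ w, r v w = t * g v w) (hP2 : Module.finrank ℝ P = 2)
    (hQ1 : Module.finrank ℝ Q = 1) :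
    ∃ b : Fin 3 → F, (∀ i j, g (b i) (b j) = if i = j then 1 else 0) ∧
      b 0 ∈ P ∧ b 1 ∈ P ∧ b 2 ∈ Q := by
  obtain ⟨u, hu, v, hv, huu, hvv, hvu⟩ := exists_orthonormal_pair hg hP2
  obtain ⟨w, hw, hww⟩ := exists_unit_mem hg (P := Q) (by rintro rfl; simp at hQ1)
  have horth : ∀ x ∈ P, g x w = 0 := fun x hx => by
    have h1 := hP x hx w
    rw [hr, hQ w hw x, hs w x] at h1
    exact (mul_eq_zero.1 (by linarith : (s - t) * g x w = 0)).resolve_left (sub_ne_zero.2 hst)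
  refine ⟨![u, v, w], fun i j => ?_, hu, hv, hw⟩
  fin_cases i <;> fin_cases j <;>
    simp [huu, hvv, hww, hvu, hs u v, horth, hu, hv, hs w u, hs w v]

end Frame

section Countable

lemma countable_image_of_fderiv_eq_zero {X : Type*} [NormedAddCommGroup X] [NormedSpace ℝ X]
    [SecondCountableTopology X] {h : X → ℝ} {W : Set X} (hW : IsOpen W)
    (hd : DifferentiableOn ℝ h W) (h0 : W.EqOn (fderiv ℝ h) 0) : (h '' W).Countable := by
  obtain ⟨t, -, htc, htW⟩ := TopologicalSpace.countable_cover_nhdsWithin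
    (f := fun x => W ∩ h ⁻¹' {h x}) fun x hx => mem_nhdsWithin_of_mem_nhds
      ((hW.isOpen_inter_preimage_of_fderiv_eq_zero hd h0 {h x}).mem_nhds ⟨hx, rfl⟩)
  refine (htc.image h).mono ?_
  rintro _ ⟨x, hx, rfl⟩
  obtain ⟨y, hy, -, hxy⟩ := Set.mem_iUnion₂.1 (htW hx)
  exact ⟨y, hy, hxy.symm⟩

lemma IsPreconnected.eq_of_locally_countable_image {X : Type*} [TopologicalSpace X]
    [SecondCountableTopology X] {f : X → ℝ} {L : Set X} (hL : IsPreconnected L)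
    (hf : ContinuousOn f L)
    (h : ∀ x ∈ L, ∃ V : Set X, IsOpen V ∧ x ∈ V ∧ (f '' (L ∩ V)).Countable) :
    ∀ x ∈ L, ∀ y ∈ L, f x = f y := by
  choose! V hVo hxV hV using h
  obtain ⟨t, htL, htc, hcov⟩ := TopologicalSpace.countable_cover_nhdsWithin
    (f := V) fun x hx => mem_nhdsWithin_of_mem_nhds ((hVo x hx).mem_nhds (hxV x hx))
  have hc : (f '' L).Countable := by
    refine (htc.biUnion fun x hx => hV x (htL hx)).mono ?_
    rintro _ ⟨x, hx, rfl⟩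
    obtain ⟨y, hy, hxy⟩ := Set.mem_iUnion₂.1 (hcov hx)
    exact Set.mem_iUnion₂.2 ⟨y, hy, x, ⟨hx, hxy⟩, rfl⟩
  intro x hx y hy
  exact hc.isTotallyDisconnected _ subset_rfl (hL.image f hf) ⟨x, hx, rfl⟩ ⟨y, hy, rfl⟩

end Countable

namespace RiemannChart

variable {n : ℕ} (D : RiemannChart n)

/-- The Christoffel symbols as a field of continuous bilinear maps. -/
def gammaL (q : E n) : E n →L[ℝ] E n →L[ℝ] E n :=
  (LinearMap.mk₂ ℝ (D.Γ q)
    (fun u v w => by simpa using D.Γ_lin q 1 u v w)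
    (fun c u w => by
      have h0 : D.Γ q 0 w = 0 := by simpa using D.Γ_lin q 1 0 0 w
      simpa [h0] using D.Γ_lin q c u 0 w)
    (fun u v w => by simpa [D.Γ_symm q u] using D.Γ_lin q 1 v w u)
    (fun c u w => by
      have h0 : D.Γ q 0 u = 0 := by simpa using D.Γ_lin q 1 0 0 u
      simpa [h0, D.Γ_symm q u] using D.Γ_lin q c w 0 u)).toContinuousBilinearMap

/-- The metric as a field of continuous bilinear forms. -/
def metricL (q : E n) : E n →L[ℝ] E n →L[ℝ] ℝ :=
  (LinearMap.mk₂ ℝ (D.g q)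
    (fun u v w => by simpa using D.g_lin q 1 u v w)
    (fun c u w => by
      have h0 : D.g q 0 w = 0 := by simpa using D.g_lin q 1 0 0 w
      simpa [h0] using D.g_lin q c u 0 w)
    (fun u v w => by simpa [D.g_symm q u] using D.g_lin q 1 v w u)
    (fun c u w => by
      have h0 : D.g q 0 u = 0 := by simpa using D.g_lin q 1 0 0 u
      simpa [h0, D.g_symm q u] using D.g_lin q c w 0 u)).toContinuousBilinearMap

lemma contDiffOn_gammaL : ContDiffOn ℝ (⊤ : ℕ∞) D.gammaL D.U :=
  contDiffOn_clm_apply.2 fun v => contDiffOn_clm_apply.2 fun w => D.Γ_smooth v w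

lemma contDiffOn_metricL : ContDiffOn ℝ (⊤ : ℕ∞) D.metricL D.U :=
  contDiffOn_clm_apply.2 fun v => contDiffOn_clm_apply.2 fun w => D.g_smooth v w

/-- The chart as a metric with Levi-Civita connection in the normed space `ℝⁿ`. -/
def toField : LeviCivitaField (E n) where
  U := D.U
  isOpen := D.hU
  G := D.metricL
  A := D.gammaL
  G_symm := D.g_symm
  A_symm := D.Γ_symm
  contDiffAt_G _ hq := D.contDiffOn_metricL.contDiffAt (D.hU.mem_nhds hq)
  contDiffAt_A _ hq := D.contDiffOn_gammaL.contDiffAt (D.hU.mem_nhds hq)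
  compat q hq m v w := by
    have h := (D.contDiffOn_metricL.contDiffAt (D.hU.mem_nhds hq)).differentiableAt (by simp)
    rw [← fderiv_clm_apply_const₂ h]
    exact D.compat q hq m v w

variable {D} {p : E n}

lemma toField_G (v w : E n) : D.toField.G p v w = D.g p v w := rfl

lemma Riem_eq_curv (hp : p ∈ D.U) (v w z : E n) : D.Riem p v w z = D.toField.curv p v w z := by
  have h := (D.toField.contDiffAt_A p hp).differentiableAt (by simp)
  simp only [LeviCivitaField.curv, ← fderiv_clm_apply_const₂ h]
  rfl

lemma sum_frame_trace {p₀ : E n} {ι : Type*} [Fintype ι] {b : ι → E n}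
    (hb : ∀ x, x = ∑ c, D.toField.G p₀ x (b c) • b c) (l : E n →ₗ[ℝ] E n) :
    ∑ i, l (e n i) i = ∑ a, D.toField.G p₀ (l (b a)) (b a) := by
  have h1 : ∀ i, l (e n i) i = ∑ a, (b a) i * D.toField.G p₀ (l (e n i)) (b a) := fun i => by
    conv_lhs => rw [hb (l (e n i))]
    simp [mul_comm]
  have h2 : ∀ x : E n, x = ∑ i, x i • e n i := fun x => by
    simpa [e] using ((EuclideanSpace.basisFun (Fin n) ℝ).sum_repr x).symm
  simp only [h1]
  rw [Finset.sum_comm]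
  refine Finset.sum_congr rfl fun a _ => ?_
  have h3 : l (b a) = l (∑ i, b a i • e n i) := by rw [← h2]
  rw [h3]
  simp

lemma Ric_eq_ricci {p₀ : E n} {ι : Type*} [Fintype ι] {b : ι → E n}
    (hb : ∀ x, x = ∑ c, D.toField.G p₀ x (b c) • b c) (hp : p ∈ D.U) (v w : E n) :
    D.Ric p v w = D.toField.ricci p₀ b p v w := by
  let l : E n →ₗ[ℝ] E n :=
    { toFun := fun x => D.toField.curv p x v w
      map_add' := fun x y => D.toField.curv_add_left p x y v w
      map_smul' := fun c x => D.toField.curv_smul_left p c x v w }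
  simp only [Ric, Riem_eq_curv hp]
  exact sum_frame_trace hb l

lemma Ric_symm {f : E n → ℝ} {lam : ℝ} (hsol : D.IsGradientSoliton f lam) (hp : p ∈ D.U)
    (v w : E n) : D.Ric p v w = D.Ric p w v := by
  have hf : ContDiffAt ℝ (⊤ : ℕ∞) f p := hsol.1.contDiffAt (D.hU.mem_nhds hp)
  have h1 := hsol.2 p hp v w
  have h2 := hsol.2 p hp w v
  simp only [Hess, fderiv_clm_apply_const hf.differentiableAt_fderiv] at h1 h2
  rw [hf.fderiv_fderiv_symm v w, D.Γ_symm p v w, D.g_symm p v w] at h1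
  linarith

/-- The eigenspace of the Ricci tensor as a submodule. -/
def ricciEigenspace (hp : p ∈ D.U) (s : ℝ) : Submodule ℝ (E n) where
  carrier := D.eigenSet D.Ric p s
  add_mem' {v v'} hv hv' w := by
    have h : D.Ric p (v + v') w = D.Ric p v w + D.Ric p v' w := by
      simp only [Ric, Riem_eq_curv hp, LeviCivitaField.curv_add_mid, PiLp.add_apply,
        Finset.sum_add_distrib]
    rw [h, hv, hv', ← toField_G, ← toField_G, ← toField_G, map_add, add_apply, mul_add]
  zero_mem' w := by
    have h : D.Ric p 0 w = 0 := by
      have h0 : ∀ x, D.toField.curv p x 0 w = 0 := fun x => by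
        simpa using D.toField.curv_smul_mid p x 0 0 w
      simp [Ric, Riem_eq_curv hp, h0]
    rw [h, ← toField_G, map_zero, zero_apply, mul_zero]
  smul_mem' c v hv w := by
    have h : D.Ric p (c • v) w = c * D.Ric p v w := by
      simp only [Ric, Riem_eq_curv hp, LeviCivitaField.curv_smul_mid, PiLp.smul_apply,
        smul_eq_mul, Finset.mul_sum]
    rw [h, hv, ← toField_G, ← toField_G, map_smul, smul_apply, smul_eq_mul]
    ring

/-- An orthonormal frame of Ricci eigenvectors, for a double eigenvalue `s` and a simple
eigenvalue `t`. -/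
lemma exists_soliton_frame {D : RiemannChart 3} {f : E 3 → ℝ} {lam : ℝ}
    (hsol : D.IsGradientSoliton f lam) {p : E 3} (hp : p ∈ D.U) {s t : ℝ}
    (hst : s ≠ t) (hs : D.eigenMult D.Ric p s = 2) (ht : D.eigenMult D.Ric p t = 1) :
    ∃ b : Fin 3 → E 3, (∀ i j, D.g p (b i) (b j) = if i = j then 1 else 0) ∧
      (∀ x, x = ∑ c, D.toField.G p x (b c) • b c) ∧
      b 0 ∈ D.eigenSet D.Ric p s ∧ b 1 ∈ D.eigenSet D.Ric p s ∧ b 2 ∈ D.eigenSet D.Ric p t := by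
  have hspan : ∀ r, Submodule.span ℝ (D.eigenSet D.Ric p r) = ricciEigenspace hp r :=
    fun r => (ricciEigenspace hp r).span_eq
  rw [eigenMult, hspan] at hs ht
  let g : E 3 →ₗ[ℝ] E 3 →ₗ[ℝ] ℝ := (D.toField.G p).toBilinForm
  obtain ⟨b, hb, h0, h1, h2⟩ := exists_adapted_frame (g := g) (D.g_symm p)
    (D.g_posdef p hp) (Ric_symm hsol hp) hst (P := ricciEigenspace hp s)
    (Q := ricciEigenspace hp t) (fun v hv => hv) (fun v hv => hv) hs ht
  exact ⟨b, hb, eq_sum_of_orthonormal (g := g) (by simp) hb, h0, h1, h2⟩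

/-- Scalar curvature, positivity of the simple Ricci eigenvalue and the gradient of the scalar
curvature on a positively curved three-dimensional soliton. -/
lemma soliton_pointwise {D : RiemannChart 3} {f : E 3 → ℝ} {lam : ℝ}
    (hsol : D.IsGradientSoliton f lam) (hpos : D.PosSec) {p : E 3} (hp : p ∈ D.U) {s t : ℝ}
    (hst : s ≠ t) (hs : D.eigenMult D.Ric p s = 2) (ht : D.eigenMult D.Ric p t = 1) :
    D.scalar p = 2 * s + t ∧ 0 < t ∧ DifferentiableAt ℝ D.scalar p ∧
      ∀ m ∈ D.eigenSet D.Ric p s, fderiv ℝ D.scalar p m = 2 * (s * fderiv ℝ f p m) := by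
  obtain ⟨b, hb, hexp, h0, h1, h2⟩ := exists_soliton_frame hsol hp hst hs ht
  have hric : ∀ q ∈ D.U, ∀ v w, D.Ric q v w = D.toField.ricci p b q v w :=
    fun q hq => Ric_eq_ricci hexp hq
  let ε := (EuclideanSpace.basisFun (Fin 3) ℝ).toBasis
  have hε : ∀ i, ε i = e 3 i := fun i => by simp [ε, e]
  have hH : ∀ q ∈ D.U, ∀ i j, ∑ k, D.ginv q (e 3 i) (e 3 k) * D.toField.G q (ε k) (ε j)
      = if i = j then 1 else 0 := fun q hq i j => by
    simp only [hε]
    exact D.ginv_g q hq i j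
  have hR : ∀ q ∈ D.U, D.scalar q
      = ∑ i, ∑ j, D.ginv q (e 3 i) (e 3 j) * D.toField.ricci p b q (ε i) (ε j) :=
    fun q hq => by simp only [hε, scalar, hric q hq]
  have hf : ContDiffAt ℝ (⊤ : ℕ∞) f p := hsol.1.contDiffAt (D.hU.mem_nhds hp)
  refine ⟨?_, ?_, LeviCivitaField.differentiableAt_scalar (C := D.toField)
    (H := fun q i j => D.ginv q (e 3 i) (e 3 j)) ε hp hH hR, fun m hm => ?_⟩
  · rw [LeviCivitaField.scalar_eq (C := D.toField)
      (H := fun q i j => D.ginv q (e 3 i) (e 3 j)) ε hp hH hexp hR]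
    simp only [← hric p hp, Fin.sum_univ_three, h0 (b 0), h1 (b 1), h2 (b 2), hb]
    simp
    ring
  · have h := h2 (b 2)
    rw [hric p hp, hb, if_pos rfl, mul_one, LeviCivitaField.ricci, Fin.sum_univ_three,
      D.toField.curv_self, map_zero, zero_apply, add_zero, ← Riem_eq_curv hp,
      ← Riem_eq_curv hp] at h
    have h02 := hpos p hp (b 0) (b 2) (by simp [hb])
    have h12 := hpos p hp (b 1) (b 2) (by simp [hb])
    rw [D.g_symm] at h02 h12
    rw [← h, toField_G, toField_G, D.g_symm, D.g_symm p _ (b 1)]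
    linarith
  · refine LeviCivitaField.fderiv_scalar_of_eigenvector (C := D.toField) (lam := lam)
      (H := fun q i j => D.ginv q (e 3 i) (e 3 j)) ε hp hH hexp hR hf
      (fun q hq v w => ?_) fun l => ?_
    · rw [← hric q hq]
      exact hsol.2 q hq v w
    · rw [← hric p hp]
      exact hm l

lemma eigenvalue_eq {D : RiemannChart 3} {f : E 3 → ℝ} {T : E 3 → E 3 → E 3 → ℝ}
    (hTdef : ∀ p v w, T p v w =
      (D.Ric p v w - D.scalar p / 2 * D.g p v w) * Real.exp (-f p))
    {p : E 3} (hp : p ∈ D.U) {s σ : ℝ} (h : D.eigenSet D.Ric p s = D.eigenSet T p σ)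
    (hs : D.eigenMult D.Ric p s ≠ 0) : σ = (s - D.scalar p / 2) * Real.exp (-f p) := by
  obtain ⟨v, hv, hv0⟩ : ∃ v ∈ D.eigenSet D.Ric p s, v ≠ 0 := by
    by_contra! hc
    exact hs (by rw [eigenMult, Submodule.span_eq_bot.2 hc, finrank_bot])
  have hg := D.g_posdef p hp v hv0
  have h1 := (h ▸ hv : v ∈ D.eigenSet T p σ) v
  rw [hTdef, hv v] at h1
  refine mul_right_cancel₀ hg.ne' ?_
  linarith

end RiemannChart

/-- Let `(M³,g)` be a three-dimensional gradient Ricci soliton with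
strictly positive sectional curvature, on which the Ricci tensor has exactly two
distinct eigenvalues, so that the Codazzi tensor `T = (Ric - (R/2) g) e^{-f}` has two
distinct eigenvalues `σ` (multiplicity 2) and `ρ` (multiplicity 1).  If `L` is a
connected component of an integral leaf of the eigendistribution `V_σ` on which both
eigenvalues of `T` are constant, then `f` is constant on `L`, and consequently the
scalar curvature `R` and both eigenvalues of the Ricci tensor are constant on `L`. -/
theorem soliton_potential_constant_on_leaves
    (D : RiemannChart 3) (f : E 3 → ℝ) (lam : ℝ)
    (hsol : D.IsGradientSoliton f lam) (hpos : D.PosSec)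
    (T : E 3 → E 3 → E 3 → ℝ)
    (hTdef : ∀ p v w, T p v w =
      (D.Ric p v w - D.scalar p / 2 * D.g p v w) * Real.exp (-f p))
    (ρ σ : E 3 → ℝ) (h2 : D.HasTwoEigenvalues T ρ σ)
    (ρR σR : E 3 → ℝ)
    (hRicEig : ∀ p ∈ D.U, ρR p ≠ σR p ∧
      D.eigenSet D.Ric p (ρR p) = D.eigenSet T p (ρ p) ∧
      D.eigenSet D.Ric p (σR p) = D.eigenSet T p (σ p))
    (L : Set (E 3)) (hLconn : IsConnected L)
    (hLleaf : D.IsIntegralHypersurface (fun q => D.eigenSet T q (σ q)) L)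
    (heig_const : ∀ p ∈ L, ∀ q ∈ L, σ p = σ q ∧ ρ p = ρ q) :
    ∀ p ∈ L, ∀ q ∈ L,
      f p = f q ∧ D.scalar p = D.scalar q ∧ σR p = σR q ∧ ρR p = ρR q := by

  have hσ : ∀ p ∈ D.U, D.eigenMult D.Ric p (σR p) = 2 := fun p hp => by
    rw [RiemannChart.eigenMult, (hRicEig p hp).2.2]
    exact h2.2.2 p hp
  have hρ : ∀ p ∈ D.U, D.eigenMult D.Ric p (ρR p) = 1 := fun p hp => by
    rw [RiemannChart.eigenMult, (hRicEig p hp).2.1]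
    exact h2.2.1 p hp
  have hpt := fun p hp => RiemannChart.soliton_pointwise hsol hpos hp (hRicEig p hp).1.symm
    (hσ p hp) (hρ p hp)
  have hTσ : ∀ p ∈ D.U, σ p = (σR p - D.scalar p / 2) * Real.exp (-f p) := fun p hp =>
    RiemannChart.eigenvalue_eq hTdef hp (hRicEig p hp).2.2 (by simp [hσ p hp])
  have hTρ : ∀ p ∈ D.U, ρ p = (ρR p - D.scalar p / 2) * Real.exp (-f p) := fun p hp =>
    RiemannChart.eigenvalue_eq hTdef hp (hRicEig p hp).2.1 (by simp [hρ p hp])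
  have hfd : ∀ p ∈ D.U, DifferentiableAt ℝ f p := fun p hp =>
    (hsol.1.contDiffAt (D.hU.mem_nhds hp)).differentiableAt (by simp)
  have hLU := hLleaf.1
  have hRf : ∀ p ∈ L, ∀ q ∈ L,
      D.scalar p * Real.exp (-f p) = D.scalar q * Real.exp (-f q) := fun p hp q hq => by
    have hc := heig_const p hp q hq
    rw [hTσ p (hLU hp), hTσ q (hLU hq), hTρ p (hLU hp), hTρ q (hLU hq)] at hc
    have hRp := (hpt p (hLU hp)).1
    have hRq := (hpt q (hLU hq)).1
    linear_combination -2 * (2 * hc.1 + hc.2) + 2 * Real.exp (-f q) * hRq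
      - 2 * Real.exp (-f p) * hRp
  have hf : ∀ p ∈ L, ∀ q ∈ L, f p = f q := by
    refine hLconn.isPreconnected.eq_of_locally_countable_image
      (fun p hp => (hfd p (hLU hp)).continuousAt.continuousWithinAt) fun q hq => ?_
    obtain ⟨φ, V, hVo, hqV, hVU, hφ, htan, hLV⟩ := hLleaf.2 q hq
    have hφL : ∀ x ∈ φ ⁻¹' V, φ x ∈ L := fun x hx =>
      (hLV.symm ▸ (⟨⟨x, rfl⟩, hx⟩ : φ x ∈ Set.range φ ∩ V) : φ x ∈ L ∩ V).1
    have hW : IsOpen (φ ⁻¹' V) := hVo.preimage hφ.continuous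
    have hφd : Differentiable ℝ φ := hφ.differentiable (by simp)
    refine ⟨V, hVo, hqV, ?_⟩
    rw [hLV, Set.inter_comm, ← Set.image_preimage_eq_inter_range, ← Set.image_comp]
    refine countable_image_of_fderiv_eq_zero hW (fun x hx =>
      ((hfd _ (hVU hx)).comp x (hφd x)).differentiableWithinAt) fun x hx => ?_
    ext u
    have hp := hVU hx
    obtain ⟨hR, hpos', hRd, hdR⟩ := hpt _ hp
    set m := fderiv ℝ φ x u with hm
    have hmem : m ∈ D.eigenSet D.Ric (φ x) (σR (φ x)) := by
      rw [(hRicEig _ hp).2.2]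
      exact (htan x hp).subset ⟨u, rfl⟩
    have h1 : HasFDerivAt (fun y => D.scalar (φ y)) _ x :=
      hRd.hasFDerivAt.comp x (hφd x).hasFDerivAt
    have h2 : HasFDerivAt (fun y => f (φ y)) _ x :=
      (hfd _ hp).hasFDerivAt.comp x (hφd x).hasFDerivAt
    have h3 := h1.mul h2.neg.exp
    have h4 : (fun y => D.scalar (φ y) * Real.exp (-f (φ y)))
        =ᶠ[𝓝 x] fun _ => D.scalar (φ x) * Real.exp (-f (φ x)) := by
      filter_upwards [hW.mem_nhds hx] with y hy using hRf _ (hφL y hy) _ (hφL x hx)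
    have h5 := h3.unique ((hasFDerivAt_const _ x).congr_of_eventuallyEq h4)
    have h6 := DFunLike.congr_fun h5 u
    simp only [add_apply, smul_apply, neg_apply, ContinuousLinearMap.comp_apply, ← hm,
      hdR m hmem, smul_eq_mul, zero_apply, hR] at h6
    have h7 : ρR (φ x) * Real.exp ((-fun y => f (φ y)) x) * fderiv ℝ f (φ x) m = 0 := by
      linear_combination -h6
    have h8 := (mul_eq_zero.1 h7).resolve_left (mul_ne_zero hpos'.ne' (Real.exp_ne_zero _))
    exact (DFunLike.congr_fun h2.fderiv u).trans h8
  intro p hp q hq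
  have hpq := hf p hp q hq
  have hR : D.scalar p = D.scalar q := by
    have h := hRf p hp q hq
    rw [hpq] at h
    exact mul_right_cancel₀ (Real.exp_ne_zero _) h
  have hc := heig_const p hp q hq
  rw [hTσ p (hLU hp), hTσ q (hLU hq), hTρ p (hLU hp), hTρ q (hLU hq), hpq, hR] at hc
  have hs := mul_right_cancel₀ (Real.exp_ne_zero _) hc.1
  have ht := mul_right_cancel₀ (Real.exp_ne_zero _) hc.2
  exact ⟨hpq, hR, by linarith, by linarith⟩

end
end
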